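/- Let n > 1 and T > 6. Let p, q : ℝⁿ → ℝ be smooth functions supported in the closed unit ball B̄, let Q = B̄×[−T,T], and let f : Q → ℝ be a bounded measurable function. Suppose α : Q → ℝ is a continuous function which is smooth on Q₊ = Q ∩ {t ≥ z} and smooth on Q₋ = Q ∩ {t ≤ z}, and which satisfies: (i) for every smooth compactly supported test function χ : ℝⁿ×ℝ → ℝ with support contained in the interior of Q, ∫_Q α(x,t)·(∂ₜ²χ(x,t) − Δₓχ(x,t) + q(x)χ(x,t)) dx dt = ∫_Q p(x) f(x,t) χ(x,t) dx dt; (ii) α(y,z,z) = ∫_{−∞}^{z} p(y,s) ds for all (y,z) ∈ B̄; and (iii) α(x,t) = 0 and the normal derivative (x·∇ₓα)(x,t) = 0 for all x ∈ S and t ∈ [−T,T] with t ≠ z (the derivative taken within the region of smoothness containing (x,t)). Then p = 0. -/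

import Mathlib

open MeasureTheory

/-- Second directional derivative of `f` at `p` in direction `v`. -/
noncomputable def dir2 {E : Type*} [NormedAddCommGroup E] [NormedSpace ℝ E]
    (f : E → ℝ) (p v : E) : ℝ :=
  iteratedDeriv 2 (fun s : ℝ => f (p + s • v)) 0

/-- The wave operator `□u = ∂ₜ²u − Δₓu` acting on functions of
`((y,z),t) ∈ (ℝ^m × ℝ) × ℝ` (so the space variable is `x = (y,z) ∈ ℝⁿ`, `n = m+1`). -/
noncomputable def waveOp (m : ℕ) (u : (EuclideanSpace ℝ (Fin m) × ℝ) × ℝ → ℝ)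
    (p : (EuclideanSpace ℝ (Fin m) × ℝ) × ℝ) : ℝ :=
  dir2 u p (0, 1)
    - ((∑ i : Fin m, dir2 u p ((EuclideanSpace.single i 1, 0), 0))
        + dir2 u p (((0 : EuclideanSpace ℝ (Fin m)), (1 : ℝ)), 0))

/-- The cylinder `Q = B̄ × [−T, T]` in `ℝⁿ × ℝ`, `n = m + 1`. -/
def cylinderQ (m : ℕ) (T : ℝ) : Set ((EuclideanSpace ℝ (Fin m) × ℝ) × ℝ) :=
  {r | ‖r.1.1‖ ^ 2 + r.1.2 ^ 2 ≤ 1 ∧ -T ≤ r.2 ∧ r.2 ≤ T}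

namespace PlaneWave

open Set Filter Topology Asymptotics

/-- Space variables `x = (y, z)`. -/
abbrev Space (m : ℕ) := EuclideanSpace ℝ (Fin m) × ℝ

/-- Space-time variables `(x, τ)`. -/
abbrev SpaceTime (m : ℕ) := Space m × ℝ

/-- The open Euclidean unit ball of `ℝ^m × ℝ`. -/
def unitBall (m : ℕ) : Set (Space m) := {x | ‖x.1‖ ^ 2 + x.2 ^ 2 < 1}

/-- The open cylinder over the unit ball with the characteristic slice `τ = 0` removed. -/
def cyl (m : ℕ) (a b : ℝ) : Set (SpaceTime m) := unitBall m ×ˢ (Ioo a b \ {0})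

variable {m : ℕ}

lemma isOpen_unitBall : IsOpen (unitBall m) :=
  isOpen_lt (by fun_prop) continuous_const

lemma isOpen_cyl (a b : ℝ) : IsOpen (cyl m a b) :=
  isOpen_unitBall.prod (isOpen_Ioo.sdiff isClosed_singleton)

lemma norm_le_one_of_mem_unitBall {x : Space m} (hx : x ∈ unitBall m) : ‖x‖ ≤ 1 := by
  have hx : ‖x.1‖ ^ 2 + x.2 ^ 2 < 1 := hx
  rw [Prod.norm_def, max_le_iff, Real.norm_eq_abs, abs_le]
  exact ⟨by nlinarith [sq_nonneg x.2, norm_nonneg x.1],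
    by nlinarith [sq_nonneg ‖x.1‖], by nlinarith [sq_nonneg ‖x.1‖]⟩

lemma isBounded_unitBall : Bornology.IsBounded (unitBall m) :=
  (Metric.isBounded_closedBall (x := (0 : Space m)) (r := 1)).subset fun x hx => by
    simpa using norm_le_one_of_mem_unitBall hx

lemma volume_unitBall_lt_top : volume (unitBall m) < ⊤ :=
  isBounded_unitBall.measure_lt_top

lemma cyl_subset {a b : ℝ} (ha : -5 ≤ a) (hb : b ≤ 5) : cyl m a b ⊆ cyl m (-5) 5 :=
  prod_mono subset_rfl (sdiff_subset_sdiff_left (Ioo_subset_Ioo ha hb))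

lemma isBounded_cyl (a b : ℝ) : Bornology.IsBounded (cyl m a b) :=
  isBounded_unitBall.prod ((Metric.isBounded_Ioo a b).subset sdiff_subset)

lemma exists_bound_of_continuous {G : Type*} [NormedAddCommGroup G] {g : SpaceTime m → G}
    (hg : Continuous g) : ∃ M, ∀ r ∈ unitBall m ×ˢ Icc (-5 : ℝ) 5, ‖g r‖ ≤ M := by
  have hK : IsCompact (closure (unitBall m ×ˢ Icc (-5 : ℝ) 5)) :=
    (isBounded_unitBall.prod (Metric.isBounded_Icc _ _)).isCompact_closure
  obtain ⟨M, hM⟩ := hK.exists_bound_of_continuousOn hg.continuousOn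
  exact ⟨M, fun r hr => hM r (subset_closure hr)⟩

lemma cyl_subset_closed : cyl m (-5) 5 ⊆ unitBall m ×ˢ Icc (-5 : ℝ) 5 :=
  prod_mono subset_rfl (sdiff_subset.trans Ioo_subset_Icc_self)

lemma integrableOn_of_continuousOn_of_bounded {Y : Type*} [TopologicalSpace Y]
    [MeasurableSpace Y] [OpensMeasurableSpace Y] {μ : Measure Y} {s : Set Y} {h : Y → ℝ}
    (hc : ContinuousOn h s) (hs : MeasurableSet s) (hμ : μ s < ⊤) {M : ℝ}
    (hM : ∀ r ∈ s, |h r| ≤ M) : IntegrableOn h s μ := by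
  have : IsFiniteMeasure (μ.restrict s) := ⟨by simpa using hμ⟩
  exact Integrable.of_bound (hc.aestronglyMeasurable hs) M
    ((ae_restrict_iff' hs).2 (ae_of_all _ hM))

lemma integrableOn_cyl {h : SpaceTime m → ℝ} (hc : ContinuousOn h (cyl m (-5) 5))
    (hb : ∃ M, ∀ r ∈ cyl m (-5) 5, |h r| ≤ M) {a b : ℝ} (ha : -5 ≤ a) (hb' : b ≤ 5) :
    IntegrableOn h (cyl m a b) := by
  obtain ⟨M, hM⟩ := hb
  exact integrableOn_of_continuousOn_of_bounded (hc.mono (cyl_subset ha hb'))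
    (isOpen_cyl a b).measurableSet (isBounded_cyl a b).measure_lt_top
    fun r hr => hM r (cyl_subset ha hb' hr)

/-- `f` is continuously differentiable off the slice `τ = 0` inside the cylinder, with derivative
`f'`, bounded together with its derivative, and vanishes to order `k` at the lateral boundary. -/
structure VanishesToOrder (k : ℕ) (f : SpaceTime m → ℝ) (f' : SpaceTime m → SpaceTime m →L[ℝ] ℝ) :
    Prop where
  hasFDerivAt : ∀ r ∈ cyl m (-5) 5, HasFDerivAt f (f' r) r
  cont : ContinuousOn f' (cyl m (-5) 5)
  bdd : ∃ M, ∀ r ∈ cyl m (-5) 5, |f r| ≤ M ∧ ‖f' r‖ ≤ M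
  bdry : ∀ x ∉ unitBall m, ∀ τ ∈ Ioo (-5 : ℝ) 5 \ {0},
    (fun x' => f (x', τ)) =O[𝓝 x] fun x' => ‖x' - x‖ ^ k

namespace VanishesToOrder

variable {k l : ℕ} {f g : SpaceTime m → ℝ} {f' g' : SpaceTime m → SpaceTime m →L[ℝ] ℝ}

lemma continuousOn (hf : VanishesToOrder k f f') : ContinuousOn f (cyl m (-5) 5) :=
  fun r hr => (hf.hasFDerivAt r hr).continuousAt.continuousWithinAt

lemma mul (hf : VanishesToOrder k f f') (hg : VanishesToOrder l g g') :
    VanishesToOrder (k + l) (fun r => f r * g r) (fun r => f r • g' r + g r • f' r) where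
  hasFDerivAt r hr := (hf.hasFDerivAt r hr).mul (hg.hasFDerivAt r hr)
  cont := (hf.continuousOn.smul hg.cont).add (hg.continuousOn.smul hf.cont)
  bdd := by
    obtain ⟨M, hM⟩ := hf.bdd
    obtain ⟨N, hN⟩ := hg.bdd
    refine ⟨M * N + N * M, fun r hr => ?_⟩
    obtain ⟨h1, h2⟩ := hM r hr
    obtain ⟨h3, h4⟩ := hN r hr
    have hM0 := (abs_nonneg _).trans h1
    have hN0 := (abs_nonneg _).trans h3
    constructor
    · rw [abs_mul]
      nlinarith [mul_le_mul h1 h3 (abs_nonneg _) hM0, mul_nonneg hN0 hM0]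
    · refine (norm_add_le _ _).trans (add_le_add ?_ ?_)
      · rw [norm_smul]; exact mul_le_mul h1 h4 (norm_nonneg _) hM0
      · rw [norm_smul]; exact mul_le_mul h3 h2 (norm_nonneg _) hN0
  bdry x hx τ hτ := by
    simpa only [pow_add] using (hf.bdry x hx τ hτ).mul (hg.bdry x hx τ hτ)

lemma add (hf : VanishesToOrder k f f') (hg : VanishesToOrder k g g') :
    VanishesToOrder k (fun r => f r + g r) (fun r => f' r + g' r) where
  hasFDerivAt r hr := (hf.hasFDerivAt r hr).add (hg.hasFDerivAt r hr)
  cont := hf.cont.add hg.cont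
  bdd := by
    obtain ⟨M, hM⟩ := hf.bdd
    obtain ⟨N, hN⟩ := hg.bdd
    exact ⟨M + N, fun r hr => ⟨(abs_add_le _ _).trans (add_le_add (hM r hr).1 (hN r hr).1),
      (norm_add_le _ _).trans (add_le_add (hM r hr).2 (hN r hr).2)⟩⟩
  bdry x hx τ hτ := (hf.bdry x hx τ hτ).add (hg.bdry x hx τ hτ)

lemma zero : VanishesToOrder (m := m) k (fun _ => 0) (fun _ => 0) where
  hasFDerivAt _ _ := hasFDerivAt_const _ _
  cont := continuousOn_const
  bdd := ⟨0, by simp⟩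
  bdry _ _ _ _ := isBigO_zero _ _

lemma sum {ι : Type*} (s : Finset ι) {f : ι → SpaceTime m → ℝ}
    {f' : ι → SpaceTime m → SpaceTime m →L[ℝ] ℝ} (h : ∀ i, VanishesToOrder k (f i) (f' i)) :
    VanishesToOrder k (fun r => ∑ i ∈ s, f i r) (fun r => ∑ i ∈ s, f' i r) := by
  classical
  induction s using Finset.induction_on with
  | empty => simpa using zero
  | insert i s hi ih => simpa [Finset.sum_insert hi] using (h i).add ih

lemma mul_left (hf : VanishesToOrder k f f') {c : SpaceTime m → ℝ}
    {c' : SpaceTime m → SpaceTime m →L[ℝ] ℝ} (hc : ∀ r, HasFDerivAt c (c' r) r)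
    (hc' : Continuous c') :
    VanishesToOrder k (fun r => c r * f r) (fun r => c r • f' r + f r • c' r) where
  hasFDerivAt r hr := (hc r).mul (hf.hasFDerivAt r hr)
  cont := by
    have : Continuous c := continuous_iff_continuousAt.2 fun r => (hc r).continuousAt
    exact (this.continuousOn.smul hf.cont).add (hf.continuousOn.smul hc'.continuousOn)
  bdd := by
    have : Continuous c := continuous_iff_continuousAt.2 fun r => (hc r).continuousAt
    obtain ⟨M, hM⟩ := hf.bdd
    obtain ⟨N, hN⟩ := exists_bound_of_continuous this
    obtain ⟨N', hN'⟩ := exists_bound_of_continuous hc'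
    refine ⟨N * M + M * N', fun r hr => ?_⟩
    obtain ⟨h1, h2⟩ := hM r hr
    have h3 := hN r (cyl_subset_closed hr)
    have h4 := hN' r (cyl_subset_closed hr)
    have hM0 := (abs_nonneg _).trans h1
    have hN0 := (norm_nonneg _).trans h3
    have hN0' := (norm_nonneg _).trans h4
    constructor
    · rw [abs_mul]
      nlinarith [mul_le_mul h3 h1 (abs_nonneg _) hN0, mul_nonneg hM0 hN0', Real.norm_eq_abs (c r)]
    · refine (norm_add_le _ _).trans (add_le_add ?_ ?_)
      · rw [norm_smul]; exact mul_le_mul h3 h2 (norm_nonneg _) hN0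
      · rw [norm_smul]; exact mul_le_mul h1 h4 (norm_nonneg _) hM0
  bdry x hx τ hτ := by
    have : Continuous c := continuous_iff_continuousAt.2 fun r => (hc r).continuousAt
    have h1 : (fun x' => c (x', τ)) =O[𝓝 x] fun _ => (1 : ℝ) :=
      (Continuous.tendsto (by fun_prop) x : Tendsto (fun x' => c (x', τ)) (𝓝 x) _).isBigO_one ℝ
    simpa using h1.mul (hf.bdry x hx τ hτ)

lemma const_mul (hf : VanishesToOrder k f f') (c : ℝ) :
    VanishesToOrder k (fun r => c * f r) (fun r => c • f' r) := by
  simpa using hf.mul_left (fun r => hasFDerivAt_const c r) continuous_const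

lemma eq_zero (hf : VanishesToOrder (k + 1) f f') {x : Space m} (hx : x ∉ unitBall m) {τ : ℝ}
    (hτ : τ ∈ Ioo (-5 : ℝ) 5 \ {0}) : f (x, τ) = 0 := by
  obtain ⟨C, hC⟩ := (hf.bdry x hx τ hτ).bound
  simpa using hC.self_of_nhds

lemma integrableOn_deriv (hf : VanishesToOrder k f f') (e : SpaceTime m) {a b : ℝ} (ha : -5 ≤ a)
    (hb : b ≤ 5) : IntegrableOn (fun r => f' r e) (cyl m a b) := by
  refine integrableOn_cyl (hf.cont.clm_apply continuousOn_const) ?_ ha hb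
  obtain ⟨M, hM⟩ := hf.bdd
  exact ⟨M * ‖e‖, fun r hr => ((f' r).le_opNorm e).trans
    (mul_le_mul_of_nonneg_right (hM r hr).2 (norm_nonneg _))⟩

/-- The spatial derivatives of a function vanishing to second order at the lateral boundary
integrate to zero. -/
lemma integral_deriv_space (hf : VanishesToOrder 2 f f') (e : Space m) {a b : ℝ} (ha : -5 ≤ a)
    (hb : b ≤ 5) : ∫ r in cyl m a b, f' r (e, 0) = 0 := by
  have hint := hf.integrableOn_deriv (e, 0) ha hb
  have hsub := cyl_subset (m := m) ha hb
  have hmeas : MeasurableSet (unitBall m) := isOpen_unitBall.measurableSet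
  have hI : MeasurableSet (Ioo a b \ {0}) := measurableSet_Ioo.diff (measurableSet_singleton 0)
  unfold cyl at hint ⊢
  rw [Measure.volume_eq_prod, ← setIntegral_prod_swap, setIntegral_prod]
  · refine setIntegral_eq_zero_of_forall_eq_zero fun τ hτ => ?_
    have hτ5 : τ ∈ Ioo (-5 : ℝ) 5 \ {0} := ⟨⟨ha.trans_lt hτ.1.1, hτ.1.2.trans_le hb⟩, hτ.2⟩
    simp only [Prod.swap]
    rw [← integral_indicator hmeas]
    set g : Space m → ℝ := fun x => f (x, τ) with hg
    set gd : Space m → ℝ := (unitBall m).indicator fun x => f' (x, τ) (e, 0) with hgd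
    have hline : ∀ x, HasLineDerivAt ℝ g (gd x) x e := by
      intro x
      by_cases hx : x ∈ unitBall m
      · have h1 : HasFDerivAt g ((f' (x, τ)).comp (ContinuousLinearMap.inl ℝ (Space m) ℝ)) x :=
          (hf.hasFDerivAt (x, τ) ⟨hx, hτ5⟩).comp x (hasFDerivAt_prodMk_left x τ)
        simpa [hgd, hx] using h1.hasLineDerivAt e
      · have h1 : HasFDerivAt g (0 : Space m →L[ℝ] ℝ) x := by
          rw [hasFDerivAt_iff_isLittleO]
          simp only [hg, hf.eq_zero hx hτ5, zero_apply, sub_zero]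
          refine (hf.bdry x hx τ hτ5).trans_isLittleO ?_
          have := isLittleO_pow_sub_sub x (m := 2) (by norm_num) (E' := Space m)
          exact this
        simpa [hgd, hx] using h1.hasLineDerivAt e
    obtain ⟨M, hM⟩ := hf.bdd
    have hsl : ∀ x ∈ unitBall m, (x, τ) ∈ cyl m (-5) 5 := fun x hx => ⟨hx, hτ5⟩
    have hmk : ContinuousOn (fun x : Space m => (x, τ)) (unitBall m) := by fun_prop
    have hgint : Integrable g := by
      have : g = (unitBall m).indicator g := by
        ext x
        by_cases hx : x ∈ unitBall m
        · simp [hx]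
        · simp [hx, hg, hf.eq_zero hx hτ5]
      rw [this, integrable_indicator_iff hmeas]
      exact integrableOn_of_continuousOn_of_bounded (hf.continuousOn.comp hmk hsl) hmeas
        volume_unitBall_lt_top fun x hx => (hM _ (hsl x hx)).1
    have hgdint : Integrable gd := by
      rw [hgd, integrable_indicator_iff hmeas]
      exact integrableOn_of_continuousOn_of_bounded
        ((hf.cont.comp hmk hsl).clm_apply continuousOn_const) hmeas
        volume_unitBall_lt_top fun x hx => ((f' (x, τ)).le_opNorm _).trans
          (mul_le_mul_of_nonneg_right (hM _ (hsl x hx)).2 (norm_nonneg _))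
    have : (volume : Measure (Space m)).IsAddHaarMeasure :=
      inferInstanceAs (Measure.prod volume volume).IsAddHaarMeasure
    have key := integral_bilinear_hasLineDerivAt_right_eq_neg_left_of_integrable
      (μ := (volume : Measure (Space m))) (f := fun _ => (1 : ℝ)) (f' := fun _ => (0 : ℝ))
      (g := g) (g' := gd) (v := e) (B := ContinuousLinearMap.mul ℝ ℝ) (by simp)
      (by simpa using hgdint)
      (by simpa using hgint) (fun x _ => (hasFDerivAt_const (1 : ℝ) x).hasLineDerivAt e)
      (fun x _ => hline x)
    simpa using key
  · exact (IntegrableOn.swap hint : _)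

/-- The `τ`-derivative integrates to the difference of the values at the two ends, also across
`τ = 0`, provided `f` is continuous in `τ`. -/
lemma integral_deriv_time (hf : VanishesToOrder k f f') {a b : ℝ} (ha : -5 ≤ a)
    (hb : b ≤ 5) (hab : a ≤ b)
    (hcont : ∀ x ∈ unitBall m, ContinuousOn (fun τ => f (x, τ)) (Icc (-5) 5)) :
    IntegrableOn (fun x => f (x, b) - f (x, a)) (unitBall m) ∧
    ∫ r in cyl m a b, f' r (0, 1) = ∫ x in unitBall m, (f (x, b) - f (x, a)) := by
  have hint := hf.integrableOn_deriv (0, 1) ha hb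
  have hmeas : MeasurableSet (unitBall m) := isOpen_unitBall.measurableSet
  have hI : MeasurableSet (Ioo a b \ {0}) := measurableSet_Ioo.diff (measurableSet_singleton 0)
  have hae : (Ioo a b \ {0} : Set ℝ) =ᵐ[volume] Ioc a b :=
    (sdiff_null_ae_eq_self (by simp)).trans Ioo_ae_eq_Ioc
  have key : ∀ x ∈ unitBall m,
      ∫ τ in Ioo a b \ {0}, f' (x, τ) (0, 1) = f (x, b) - f (x, a) := by
    intro x hx
    rw [setIntegral_congr_set hae, ← intervalIntegral.integral_of_le hab]
    have hsl : ∀ τ ∈ Ioo a b \ {0}, (x, τ) ∈ cyl m (-5) 5 := fun τ hτ =>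
      cyl_subset ha hb ⟨hx, hτ⟩
    refine integral_eq_of_hasDerivAt_off_countable_of_le (fun τ => f (x, τ)) _ hab
      (countable_singleton (0 : ℝ)) ((hcont x hx).mono (Icc_subset_Icc ha hb)) (fun τ hτ => ?_) ?_
    · have h1 := (hf.hasFDerivAt (x, τ) (hsl τ hτ)).comp τ (hasFDerivAt_prodMk_right x τ)
      simpa [Function.comp_def] using h1.hasDerivAt
    · rw [intervalIntegrable_iff_integrableOn_Ioc_of_le hab]
      refine IntegrableOn.congr_set_ae ?_ hae.symm
      obtain ⟨M, hM⟩ := hf.bdd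
      exact integrableOn_of_continuousOn_of_bounded
        ((hf.cont.comp (by fun_prop) hsl).clm_apply continuousOn_const) hI
        ((measure_mono sdiff_subset).trans_lt (measure_Ioo_lt_top (a := a) (b := b)))
        fun τ hτ => ((f' (x, τ)).le_opNorm _).trans
          (mul_le_mul_of_nonneg_right (hM _ (hsl τ hτ)).2 (norm_nonneg _))
  unfold cyl at hint ⊢
  rw [Measure.volume_eq_prod] at hint
  constructor
  · have h2 : Integrable (fun r => f' r (0, 1))
        ((volume.restrict (unitBall m)).prod (volume.restrict (Ioo a b \ {0}))) := by
      rw [Measure.prod_restrict]; exact hint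
    exact (h2.integral_prod_left).congr ((ae_restrict_iff' hmeas).2 (ae_of_all _ key))
  · rw [Measure.volume_eq_prod (Space m) ℝ, setIntegral_prod _ hint]
    exact setIntegral_congr_fun hmeas key

end VanishesToOrder

/-- The coordinate direction `yᵢ`. -/
noncomputable def ey (i : Fin m) : SpaceTime m := ((EuclideanSpace.single i 1, 0), 0)

/-- The coordinate direction `z`. -/
def ez : SpaceTime m := ((0, 1), 0)

/-- The coordinate direction `τ`. -/
def et : SpaceTime m := (0, 1)

/-- The coordinate `yᵢ` as a continuous linear functional. -/
noncomputable def coordY (i : Fin m) : SpaceTime m →L[ℝ] ℝ :=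
  (EuclideanSpace.proj i).comp
    ((ContinuousLinearMap.fst ℝ _ _).comp (ContinuousLinearMap.fst ℝ _ _))

/-- The coordinate `z` as a continuous linear functional. -/
noncomputable def coordZ : SpaceTime m →L[ℝ] ℝ :=
  (ContinuousLinearMap.snd ℝ _ _).comp (ContinuousLinearMap.fst ℝ _ _)

/-- The coordinate `τ` as a continuous linear functional. -/
noncomputable def coordT : SpaceTime m →L[ℝ] ℝ := ContinuousLinearMap.snd ℝ _ _

@[simp] lemma coordY_apply (i : Fin m) (r : SpaceTime m) : coordY i r = r.1.1 i := rfl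
@[simp] lemma coordZ_apply (r : SpaceTime m) : coordZ r = r.1.2 := rfl
@[simp] lemma coordT_apply (r : SpaceTime m) : coordT r = r.2 := rfl

@[simp] lemma ey_y (i j : Fin m) : (ey i : SpaceTime m).1.1 j = if j = i then 1 else 0 := by
  simp [ey]
@[simp] lemma ey_z (i : Fin m) : (ey i : SpaceTime m).1.2 = 0 := rfl
@[simp] lemma ey_t (i : Fin m) : (ey i : SpaceTime m).2 = 0 := rfl
@[simp] lemma ez_y (j : Fin m) : (ez : SpaceTime m).1.1 j = 0 := rfl
@[simp] lemma ez_z : (ez : SpaceTime m).1.2 = 1 := rfl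
@[simp] lemma ez_t : (ez : SpaceTime m).2 = 0 := rfl
@[simp] lemma et_y (j : Fin m) : (et : SpaceTime m).1.1 j = 0 := rfl
@[simp] lemma et_z : (et : SpaceTime m).1.2 = 0 := rfl
@[simp] lemma et_t : (et : SpaceTime m).2 = 1 := rfl

/-- A linear functional is determined by its values in the coordinate directions. -/
lemma linear_eq_sum (ℓ : SpaceTime m →L[ℝ] ℝ) (ξ : SpaceTime m) :
    ℓ ξ = ∑ i, ξ.1.1 i * ℓ (ey i) + ξ.1.2 * ℓ ez + ξ.2 * ℓ et := by
  have h : ξ = ∑ i, ξ.1.1 i • (ey i : SpaceTime m) + ξ.1.2 • ez + ξ.2 • et := by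
    refine Prod.ext (Prod.ext ?_ ?_) ?_
    · ext j
      simp [Prod.fst_sum, ey, ez, et, Pi.single_apply]
    · simp [Prod.fst_sum, Prod.snd_sum, ey, ez, et]
    · simp [Prod.snd_sum, ey, ez, et]
  conv_lhs => rw [h]
  simp

/-- A function on the cylinder with first derivative `u1` and second derivatives `u2`
(`u2 r e ξ` being the derivative of `u1 · e` in the direction `ξ`), vanishing together with its
gradient at the lateral boundary, and continuous in `τ` across `τ = 0` together with its spatial
gradient. -/
structure Admissible (u : SpaceTime m → ℝ) (u1 : SpaceTime m → SpaceTime m →L[ℝ] ℝ)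
    (u2 : SpaceTime m → SpaceTime m → SpaceTime m →L[ℝ] ℝ) : Prop where
  base : VanishesToOrder 1 u u1
  deriv : ∀ e, VanishesToOrder 1 (fun r => u1 r e) (fun r => u2 r e)
  symm : ∀ r ∈ cyl m (-5) 5, ∀ e ξ, u2 r e ξ = u2 r ξ e
  base_cont : ∀ x ∈ unitBall m, ContinuousOn (fun τ => u (x, τ)) (Icc (-5) 5)
  deriv_cont : ∀ x ∈ unitBall m, ∀ e : Space m,
    ContinuousOn (fun τ => u1 (x, τ) (e, 0)) (Icc (-5) 5)

/-- The principal part `2 ∂_z ∂_τ - Δ` of the wave operator in the coordinates `τ = t - z`,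
in terms of the second derivatives. -/
noncomputable def prin (u2 : SpaceTime m → SpaceTime m → SpaceTime m →L[ℝ] ℝ)
    (r : SpaceTime m) : ℝ :=
  2 * u2 r ez et - u2 r ez ez - ∑ i, u2 r (ey i) (ey i)

/-- The quadratic form of the principal part. -/
noncomputable def nullForm (u1 : SpaceTime m → SpaceTime m →L[ℝ] ℝ) (r : SpaceTime m) : ℝ :=
  2 * (u1 r ez * u1 r et) - u1 r ez * u1 r ez - ∑ i, u1 r (ey i) * u1 r (ey i)

/-- The derivative of `nullForm`. -/
noncomputable def nullForm' (u1 : SpaceTime m → SpaceTime m →L[ℝ] ℝ)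
    (u2 : SpaceTime m → SpaceTime m → SpaceTime m →L[ℝ] ℝ) (r : SpaceTime m) :
    SpaceTime m →L[ℝ] ℝ :=
  (2 * u1 r ez) • u2 r et + (2 * u1 r et) • u2 r ez - (2 * u1 r ez) • u2 r ez
    - ∑ i, (2 * u1 r (ey i)) • u2 r (ey i)

lemma VanishesToOrder.congr {k : ℕ} {f g : SpaceTime m → ℝ}
    {f' g' : SpaceTime m → SpaceTime m →L[ℝ] ℝ} (hf : VanishesToOrder k f f')
    (h : ∀ r, g r = f r) (h' : ∀ r ξ, g' r ξ = f' r ξ) : VanishesToOrder k g g' := by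
  obtain rfl : g = f := funext h
  obtain rfl : g' = f' := funext fun r => ContinuousLinearMap.ext (h' r)
  exact hf

namespace Admissible

variable {u : SpaceTime m → ℝ} {u1 : SpaceTime m → SpaceTime m →L[ℝ] ℝ}
  {u2 : SpaceTime m → SpaceTime m → SpaceTime m →L[ℝ] ℝ}

lemma nullForm (hu : Admissible u u1 u2) :
    VanishesToOrder 2 (nullForm u1) (nullForm' u1 u2) := by
  have h1 := ((hu.deriv ez).mul (hu.deriv et)).const_mul 2
  have h2 := ((hu.deriv ez).mul (hu.deriv ez)).const_mul (-1)
  have h3 := (VanishesToOrder.sum Finset.univ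
    fun i : Fin m => (hu.deriv (ey i)).mul (hu.deriv (ey i))).const_mul (-1)
  refine ((h1.add h2).add h3).congr (fun r => ?_) (fun r ξ => ?_)
  · simp only [PlaneWave.nullForm]; ring
  · simp only [nullForm', _root_.add_apply, _root_.sub_apply, _root_.smul_apply, _root_.sum_apply,
      smul_eq_mul]
    have : ∑ i, (u1 r (ey i) * u2 r (ey i) ξ + u1 r (ey i) * u2 r (ey i) ξ)
        = ∑ i, 2 * u1 r (ey i) * u2 r (ey i) ξ := Finset.sum_congr rfl fun i _ => by ring
    rw [this]
    ring

/-- Integration of the divergence of the vector field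
`h(du) H + R X`, where `h` is the metric of the principal part. -/
lemma integral_divergence (hu : Admissible u u1 u2)
    {H R : SpaceTime m → ℝ} {H' R' : SpaceTime m → SpaceTime m →L[ℝ] ℝ}
    (hH : VanishesToOrder 1 H H') (hR : VanishesToOrder 2 R R')
    {X : SpaceTime m → SpaceTime m} {X' : SpaceTime m → SpaceTime m →L[ℝ] SpaceTime m}
    (hX : ∀ r, HasFDerivAt X (X' r) r) (hX' : Continuous X') {D : ℝ}
    (hD : ∀ r, ∑ i, (X' r (ey i)).1.1 i + (X' r ez).1.2 + (X' r et).2 = D)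
    {a b : ℝ} (ha : -5 ≤ a) (hb : b ≤ 5) (hab : a ≤ b)
    (hcont : ∀ x ∈ unitBall m,
      ContinuousOn (fun τ => u1 (x, τ) ez * H (x, τ) + (X (x, τ)).2 * R (x, τ)) (Icc (-5) 5)) :
    let div : SpaceTime m → ℝ := fun r => prin u2 r * H r
      + (- ∑ i, u1 r (ey i) * H' r (ey i) + (u1 r et - u1 r ez) * H' r ez + u1 r ez * H' r et)
      + R' r (X r) + D * R r
    let flux : SpaceTime m → ℝ := fun r => u1 r ez * H r + (X r).2 * R r
    IntegrableOn div (cyl m a b) ∧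
    IntegrableOn (fun x => flux (x, b) - flux (x, a)) (unitBall m) ∧
    ∫ r in cyl m a b, div r = ∫ x in unitBall m, (flux (x, b) - flux (x, a)) := by
  intro div flux
  have comp (ℓ : SpaceTime m →L[ℝ] ℝ) :
      VanishesToOrder 2 (fun r => ℓ (X r) * R r)
        (fun r => ℓ (X r) • R' r + R r • ℓ.comp (X' r)) :=
    hR.mul_left (fun r => ℓ.hasFDerivAt.comp r (hX r)) (continuous_const.clm_comp hX')
  have hFy (i : Fin m) := (((hu.deriv (ey i)).mul hH).const_mul (-1)).add (comp (coordY i))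
  have hFz := (((hu.deriv et).add ((hu.deriv ez).const_mul (-1))).mul hH).add (comp coordZ)
  have hFt := ((hu.deriv ez).mul hH).add (comp coordT)
  have hiy (i : Fin m) := (hFy i).integrableOn_deriv (ey i) ha hb
  have hiz := hFz.integrableOn_deriv ez ha hb
  have hit := hFt.integrableOn_deriv et ha hb
  have zy (i : Fin m) := (hFy i).integral_deriv_space (EuclideanSpace.single i 1, 0) ha hb
  have zz := hFz.integral_deriv_space (0, 1) ha hb
  obtain ⟨ht1, ht2⟩ := hFt.integral_deriv_time ha hb hab hcont
  have hsum := ((integrable_finsetSum Finset.univ fun i _ => hiy i).add hiz).add hit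
  have hdiv : ∀ r ∈ cyl m a b, ∑ i, (((-1 : ℝ) • (u1 r (ey i) • H' r + H r • u2 r (ey i)) +
        (coordY i (X r) • R' r + R r • (coordY i).comp (X' r))) : SpaceTime m →L[ℝ] ℝ) (ey i)
      + (((u1 r et + -1 * u1 r ez) • H' r + H r • (u2 r et + (-1 : ℝ) • u2 r ez)) +
        (coordZ (X r) • R' r + R r • coordZ.comp (X' r)) : SpaceTime m →L[ℝ] ℝ) ez
      + ((u1 r ez • H' r + H r • u2 r ez) +
        (coordT (X r) • R' r + R r • coordT.comp (X' r)) : SpaceTime m →L[ℝ] ℝ) et = div r := by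
    intro r hr
    have hs := hu.symm r (cyl_subset ha hb hr)
    show _ = prin u2 r * H r
      + (- ∑ i, u1 r (ey i) * H' r (ey i) + (u1 r et - u1 r ez) * H' r ez + u1 r ez * H' r et)
      + R' r (X r) + D * R r
    rw [← hD r, linear_eq_sum (R' r) (X r), prin]
    have e1 : ∑ i, (((-1 : ℝ) • (u1 r (ey i) • H' r + H r • u2 r (ey i)) +
        (coordY i (X r) • R' r + R r • (coordY i).comp (X' r))) : SpaceTime m →L[ℝ] ℝ) (ey i)
        = - ∑ i, u1 r (ey i) * H' r (ey i) - (∑ i, u2 r (ey i) (ey i)) * H r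
          + ∑ i, (X r).1.1 i * R' r (ey i) + (∑ i, (X' r (ey i)).1.1 i) * R r := by
      rw [Finset.sum_mul, Finset.sum_mul, ← Finset.sum_neg_distrib, ← Finset.sum_sub_distrib,
        ← Finset.sum_add_distrib, ← Finset.sum_add_distrib]
      refine Finset.sum_congr rfl fun i _ => ?_
      simp
      ring
    rw [e1]
    simp [hs et ez]
    ring
  have hms := (isOpen_cyl (m := m) a b).measurableSet
  refine ⟨IntegrableOn.congr_fun hsum hdiv hms, ht1, ?_⟩
  rw [← setIntegral_congr_fun hms hdiv]
  have e3 : ∑ i, ∫ r in cyl m a b, (((-1 : ℝ) • (u1 r (ey i) • H' r + H r • u2 r (ey i)) +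
        (coordY i (X r) • R' r + R r • (coordY i).comp (X' r))) : SpaceTime m →L[ℝ] ℝ) (ey i) = 0 :=
    Finset.sum_eq_zero fun i _ => zy i
  have hy := integrable_finsetSum Finset.univ fun i _ => hiy i
  refine (integral_add (hy.add hiz) hit).trans ?_
  refine (congrArg₂ (· + ·) ((integral_add hy hiz).trans (congrArg₂ (· + ·)
    ((integral_finsetSum _ fun i _ => hiy i).trans e3) zz)) ht2).trans ?_
  simp [flux]

end Admissible

/-- Continuous bounded functions on the cylinder. -/
def BoundedContinuous (h : SpaceTime m → ℝ) : Prop :=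
  ContinuousOn h (cyl m (-5) 5) ∧ ∃ M, ∀ r ∈ cyl m (-5) 5, |h r| ≤ M

namespace BoundedContinuous

variable {f g : SpaceTime m → ℝ}

lemma integrableOn (hf : BoundedContinuous f) {a b : ℝ} (ha : -5 ≤ a) (hb : b ≤ 5) :
    IntegrableOn f (cyl m a b) :=
  integrableOn_cyl hf.1 hf.2 ha hb

lemma mul (hf : BoundedContinuous f) (hg : BoundedContinuous g) :
    BoundedContinuous (fun r => f r * g r) := by
  obtain ⟨hf, M, hM⟩ := hf
  obtain ⟨hg, N, hN⟩ := hg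
  refine ⟨hf.mul hg, M * N, fun r hr => ?_⟩
  rw [abs_mul]
  exact mul_le_mul (hM r hr) (hN r hr) (abs_nonneg _) ((abs_nonneg _).trans (hM r hr))

lemma add (hf : BoundedContinuous f) (hg : BoundedContinuous g) :
    BoundedContinuous (fun r => f r + g r) := by
  obtain ⟨hf, M, hM⟩ := hf
  obtain ⟨hg, N, hN⟩ := hg
  exact ⟨hf.add hg, M + N, fun r hr => (abs_add_le _ _).trans (add_le_add (hM r hr) (hN r hr))⟩

lemma of_continuous (hf : Continuous f) : BoundedContinuous f := by
  obtain ⟨M, hM⟩ := exists_bound_of_continuous hf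
  exact ⟨hf.continuousOn, M, fun r hr => hM r (cyl_subset_closed hr)⟩

lemma const (c : ℝ) : BoundedContinuous (fun _ : SpaceTime m => c) :=
  of_continuous continuous_const

lemma const_mul (hf : BoundedContinuous f) (c : ℝ) : BoundedContinuous (fun r => c * f r) :=
  (const c).mul hf

lemma sub (hf : BoundedContinuous f) (hg : BoundedContinuous g) :
    BoundedContinuous (fun r => f r - g r) := by
  simpa [sub_eq_add_neg] using hf.add (hg.const_mul (-1))

lemma pow (hf : BoundedContinuous f) (k : ℕ) : BoundedContinuous (fun r => f r ^ k) := by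
  induction k with
  | zero => simpa using const 1
  | succ k ih => simpa [pow_succ] using ih.mul hf

lemma sum {f : Fin m → SpaceTime m → ℝ} (hf : ∀ i, BoundedContinuous (f i)) :
    BoundedContinuous (fun r => ∑ i, f i r) := by
  have : ∀ s : Finset (Fin m), BoundedContinuous (fun r => ∑ i ∈ s, f i r) := by
    intro s
    induction s using Finset.induction_on with
    | empty => simpa using const 0
    | insert i s hi ih => simpa [Finset.sum_insert hi] using (hf i).add ih
  exact this _

end BoundedContinuous

lemma VanishesToOrder.boundedContinuous {k : ℕ} {f : SpaceTime m → ℝ}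
    {f' : SpaceTime m → SpaceTime m →L[ℝ] ℝ} (hf : VanishesToOrder k f f') :
    BoundedContinuous f :=
  ⟨hf.continuousOn, hf.bdd.imp fun _ h r hr => (h r hr).1⟩

lemma VanishesToOrder.boundedContinuous_deriv {k : ℕ} {f : SpaceTime m → ℝ}
    {f' : SpaceTime m → SpaceTime m →L[ℝ] ℝ} (hf : VanishesToOrder k f f') (e : SpaceTime m) :
    BoundedContinuous fun r => f' r e := by
  refine ⟨hf.cont.clm_apply continuousOn_const, ?_⟩
  obtain ⟨M, hM⟩ := hf.bdd
  exact ⟨M * ‖e‖, fun r hr => ((f' r).le_opNorm e).trans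
    (mul_le_mul_of_nonneg_right (hM r hr).2 (norm_nonneg _))⟩

namespace Admissible

variable {u : SpaceTime m → ℝ} {u1 : SpaceTime m → SpaceTime m →L[ℝ] ℝ}
  {u2 : SpaceTime m → SpaceTime m → SpaceTime m →L[ℝ] ℝ}

lemma mul_smooth (hu : Admissible u u1 u2) {g : SpaceTime m → ℝ}
    {g1 : SpaceTime m → SpaceTime m →L[ℝ] ℝ}
    {g2 : SpaceTime m → SpaceTime m → SpaceTime m →L[ℝ] ℝ}
    (hg : ∀ r, HasFDerivAt g (g1 r) r) (hg1 : ∀ e r, HasFDerivAt (fun r => g1 r e) (g2 r e) r)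
    (hg1c : Continuous g1) (hg2c : ∀ e, Continuous fun r => g2 r e)
    (hsymm : ∀ r e ξ, g2 r e ξ = g2 r ξ e) :
    Admissible (fun r => g r * u r) (fun r => g r • u1 r + u r • g1 r)
      (fun r e => g r • u2 r e + u1 r e • g1 r + (g1 r e • u1 r + u r • g2 r e)) where
  base := hu.base.mul_left hg hg1c
  deriv e := by
    refine (((hu.deriv e).mul_left hg hg1c).add
      (hu.base.mul_left (hg1 e) (hg2c e))).congr (fun r => ?_) (fun r ξ => ?_)
    · simp [mul_comm]
    · simp
  symm r hr e ξ := by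
    simp [hu.symm r hr e ξ, hsymm r e ξ]
    ring
  base_cont x hx := by
    have hc : Continuous g := continuous_iff_continuousAt.2 fun r => (hg r).continuousAt
    exact (hc.comp (Continuous.prodMk_right x)).continuousOn.mul (hu.base_cont x hx)
  deriv_cont x hx e := by
    have hc : Continuous g := continuous_iff_continuousAt.2 fun r => (hg r).continuousAt
    refine ((hc.comp (Continuous.prodMk_right x)).continuousOn.mul (hu.deriv_cont x hx e)).add
      ((hu.base_cont x hx).mul (Continuous.continuousOn ?_))
    exact (hg1c.comp (Continuous.prodMk_right x)).clm_apply continuous_const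

/-- The derivative of `u` along a vector field. -/
lemma deriv_along (hu : Admissible u u1 u2) {X : SpaceTime m → SpaceTime m}
    {X' : SpaceTime m → SpaceTime m →L[ℝ] SpaceTime m}
    (hX : ∀ r, HasFDerivAt X (X' r) r) (hX' : Continuous X') :
    ∃ W' : SpaceTime m → SpaceTime m →L[ℝ] ℝ, VanishesToOrder 1 (fun r => u1 r (X r)) W' ∧
      ∀ r ∈ cyl m (-5) 5, ∀ ξ, W' r ξ = u2 r ξ (X r) + u1 r (X' r ξ) := by
  have comp (ℓ : SpaceTime m →L[ℝ] ℝ) (e : SpaceTime m) :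
      VanishesToOrder 1 (fun r => ℓ (X r) * u1 r e)
        (fun r => ℓ (X r) • u2 r e + u1 r e • ℓ.comp (X' r)) :=
    (hu.deriv e).mul_left (fun r => ℓ.hasFDerivAt.comp r (hX r)) (continuous_const.clm_comp hX')
  have h := ((VanishesToOrder.sum Finset.univ fun i => comp (coordY i) (ey i)).add
    (comp coordZ ez)).add (comp coordT et)
  refine ⟨_, h.congr (fun r => ?_) (fun r ξ => rfl), fun r hr ξ => ?_⟩
  · rw [linear_eq_sum]; simp
  · rw [linear_eq_sum (u2 r ξ), linear_eq_sum (u1 r) (X' r ξ)]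
    simp [hu.symm r hr ξ, Finset.sum_add_distrib]
    simp [mul_comm]
    ring

end Admissible

/-- The linear part of the Carleman multiplier field. -/
noncomputable def fieldDeriv : SpaceTime m →L[ℝ] SpaceTime m :=
  (((9 / 10 : ℝ) • (ContinuousLinearMap.fst ℝ _ _).comp (ContinuousLinearMap.fst ℝ _ _)).prod
    ((2 : ℝ) • coordZ + (47 / 100 : ℝ) • coordT)).prod ((-2 : ℝ) • coordZ)

/-- The Carleman multiplier field: the negative of the gradient of `weight c` with respect to the
principal part. -/
noncomputable def field (c : EuclideanSpace ℝ (Fin m)) (r : SpaceTime m) : SpaceTime m :=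
  fieldDeriv (r - ((c, 0), 0))

lemma hasFDerivAt_field (c : EuclideanSpace ℝ (Fin m)) (r : SpaceTime m) :
    HasFDerivAt (field c) fieldDeriv r :=
  fieldDeriv.hasFDerivAt.comp r ((hasFDerivAt_id r).sub_const _)

@[simp] lemma field_y (c : EuclideanSpace ℝ (Fin m)) (r : SpaceTime m) (i : Fin m) :
    (field c r).1.1 i = 9 / 10 * (r.1.1 i - c i) := by simp [field, fieldDeriv]
@[simp] lemma field_z (c : EuclideanSpace ℝ (Fin m)) (r : SpaceTime m) :
    (field c r).1.2 = 2 * r.1.2 + 47 / 100 * r.2 := by simp [field, fieldDeriv]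
@[simp] lemma field_t (c : EuclideanSpace ℝ (Fin m)) (r : SpaceTime m) :
    (field c r).2 = -2 * r.1.2 := by simp [field, fieldDeriv]

lemma fieldDeriv_ey (i : Fin m) : fieldDeriv (ey i : SpaceTime m) = (9 / 10 : ℝ) • ey i := by
  simp [fieldDeriv, ey]

lemma fieldDeriv_ez : fieldDeriv (ez : SpaceTime m) = (2 : ℝ) • ez - (2 : ℝ) • et := by
  simp [fieldDeriv, ez, et]

lemma fieldDeriv_et : fieldDeriv (et : SpaceTime m) = (47 / 100 : ℝ) • ez := by
  simp [fieldDeriv, ez, et]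

/-- The zeroth-order coefficient of the conjugated operator. -/
noncomputable def coeff (σ : ℝ) (c : EuclideanSpace ℝ (Fin m)) (r : SpaceTime m) : ℝ :=
  -4 * σ ^ 2 * (81 / 400 * ∑ i, (r.1.1 i - c i) ^ 2 + r.1.2 ^ 2 + 47 / 100 * (r.1.2 * r.2))
    + 8 / 5 * σ

/-- The derivative of `coeff`. -/
noncomputable def coeff' (σ : ℝ) (c : EuclideanSpace ℝ (Fin m)) (r : SpaceTime m) :
    SpaceTime m →L[ℝ] ℝ :=
  (-4 * σ ^ 2) • ((81 / 400 : ℝ) • ∑ i, (2 * (r.1.1 i - c i)) • coordY i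
    + (2 * r.1.2) • coordZ + (47 / 100 : ℝ) • (r.1.2 • coordT + r.2 • coordZ))

lemma hasFDerivAt_sum_sq (c : EuclideanSpace ℝ (Fin m)) (r : SpaceTime m) :
    HasFDerivAt (fun r : SpaceTime m => ∑ i, (r.1.1 i - c i) ^ 2)
      (∑ i, (2 * (r.1.1 i - c i)) • coordY i) r := by
  refine HasFDerivAt.fun_sum fun i _ => ?_
  simpa using ((coordY i).hasFDerivAt (x := r)).sub_const (c i) |>.pow 2

lemma hasFDerivAt_coeff (σ : ℝ) (c : EuclideanSpace ℝ (Fin m)) (r : SpaceTime m) :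
    HasFDerivAt (coeff σ c) (coeff' σ c r) r := by
  have hz : HasFDerivAt (fun r : SpaceTime m => r.1.2) coordZ r := coordZ.hasFDerivAt
  have ht : HasFDerivAt (fun r : SpaceTime m => r.2) coordT r := coordT.hasFDerivAt
  have hz2 : HasFDerivAt (fun r : SpaceTime m => r.1.2 ^ 2) ((2 * r.1.2) • coordZ) r := by
    simpa using hz.pow 2
  exact ((((hasFDerivAt_sum_sq c r).const_mul _).add hz2).add
    ((hz.mul ht).const_mul _)).const_mul _ |>.add_const _

lemma continuous_coeff' (σ : ℝ) (c : EuclideanSpace ℝ (Fin m)) : Continuous (coeff' σ c) := by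
  unfold coeff'
  fun_prop

/-- The spatial energy density. -/
noncomputable def energy (u1 : SpaceTime m → SpaceTime m →L[ℝ] ℝ) (r : SpaceTime m) : ℝ :=
  u1 r ez ^ 2 + ∑ i, u1 r (ey i) ^ 2

lemma energy_nonneg (u1 : SpaceTime m → SpaceTime m →L[ℝ] ℝ) (r : SpaceTime m) :
    0 ≤ energy u1 r :=
  add_nonneg (sq_nonneg _) (Finset.sum_nonneg fun _ _ => sq_nonneg _)

/-- The Carleman multiplier. -/
noncomputable def multiplier (c : EuclideanSpace ℝ (Fin m)) (v : SpaceTime m → ℝ)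
    (v1 : SpaceTime m → SpaceTime m →L[ℝ] ℝ) (r : SpaceTime m) : ℝ :=
  2 * v1 r (field c r) + (9 / 10 * m + 2 / 5) * v r

/-- The energy flux through the slices of constant `τ`. -/
noncomputable def carlemanFlux (σ : ℝ) (c : EuclideanSpace ℝ (Fin m)) (v : SpaceTime m → ℝ)
    (v1 : SpaceTime m → SpaceTime m →L[ℝ] ℝ) (r : SpaceTime m) : ℝ :=
  v1 r ez * multiplier c v v1 r + (field c r).2 * (coeff σ c r * v r ^ 2 - nullForm v1 r)

lemma carlemanFlux_eq (σ : ℝ) (c : EuclideanSpace ℝ (Fin m)) (v : SpaceTime m → ℝ)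
    (v1 : SpaceTime m → SpaceTime m →L[ℝ] ℝ) (r : SpaceTime m) :
    carlemanFlux σ c v v1 r =
      2 * v1 r ez * (9 / 10 * ∑ i, (r.1.1 i - c i) * v1 r (ey i)
        + (2 * r.1.2 + 47 / 100 * r.2) * v1 r ez)
      + (9 / 10 * m + 2 / 5) * (v r * v1 r ez)
      - 2 * r.1.2 * (coeff σ c r * v r ^ 2 + energy v1 r) := by
  rw [carlemanFlux, multiplier, linear_eq_sum (v1 r) (field c r), nullForm, energy]
  simp only [field_y, field_z, field_t, Finset.mul_sum, ← pow_two]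
  simp only [mul_assoc]
  ring

/-- Lower bound for the zeroth-order form in the Carleman estimate. -/
lemma zeroth_form_lower_bound {Y z τ : ℝ} (hY : 121 / 25 ≤ Y) (hz : z ^ 2 ≤ 1)
    (hτ : τ ^ 2 ≤ 25) :
    2 / 25 ≤ 172125 / 1000000 * Y + 1165 / 1000 * z ^ 2 + 658 / 1000 * (z * τ)
      + 55225 / 1000000 * τ ^ 2 := by
  nlinarith [sq_nonneg (5 * z + τ), sq_nonneg (z + τ), sq_nonneg (z - τ)]

lemma sq_add_le_of_lower_bound {σ F : ℝ} (hσ : 10 ≤ σ) (hF : 2 / 25 ≤ F) :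
    σ ^ 2 ≤ 16 * σ ^ 2 * F - 64 / 25 * σ := by
  nlinarith [mul_le_mul_of_nonneg_left hF (sq_nonneg σ)]

lemma mul_le_inv_mul_sq {σ : ℝ} (hσ : 0 < σ) (a h : ℝ) :
    a * h ≤ (4 * σ)⁻¹ * (a + σ * h) ^ 2 := by
  rw [inv_mul_eq_div, le_div_iff₀ (by linarith)]
  linarith [sq_nonneg (a - σ * h), (by ring :
    (a + σ * h) ^ 2 = (a - σ * h) ^ 2 + a * h * (4 * σ))]

namespace Admissible

variable {v : SpaceTime m → ℝ} {v1 : SpaceTime m → SpaceTime m →L[ℝ] ℝ}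
  {v2 : SpaceTime m → SpaceTime m → SpaceTime m →L[ℝ] ℝ}

lemma boundedContinuous_energy (hv : Admissible v v1 v2) : BoundedContinuous (energy v1) :=
  ((hv.deriv ez).boundedContinuous.pow 2).add
    (BoundedContinuous.sum fun i => (hv.deriv (ey i)).boundedContinuous.pow 2)

lemma boundedContinuous_prin (hv : Admissible v v1 v2) : BoundedContinuous (prin v2) :=
  ((((hv.deriv ez).boundedContinuous_deriv et).const_mul 2).sub
    ((hv.deriv ez).boundedContinuous_deriv ez)).sub
    (BoundedContinuous.sum fun i => (hv.deriv (ey i)).boundedContinuous_deriv (ey i))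

lemma continuousOn_carlemanFlux (hv : Admissible v v1 v2) (σ : ℝ)
    (c : EuclideanSpace ℝ (Fin m)) {x : Space m} (hx : x ∈ unitBall m) :
    ContinuousOn (fun τ => carlemanFlux σ c v v1 (x, τ)) (Icc (-5) 5) := by
  simp only [carlemanFlux_eq, energy]
  have hz := hv.deriv_cont x hx (0, 1)
  have hy (i : Fin m) := hv.deriv_cont x hx (EuclideanSpace.single i 1, 0)
  have hv0 := hv.base_cont x hx
  have hk : ContinuousOn (fun τ => coeff σ c (x, τ)) (Icc (-5) 5) := by
    unfold coeff
    fun_prop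
  change ContinuousOn (fun τ => v1 (x, τ) ez) _ at hz
  change ∀ i, ContinuousOn (fun τ => v1 (x, τ) (ey i)) _ at hy
  obtain ⟨fz, hfz⟩ : ∃ fz : ℝ → ℝ, ∀ τ, v1 (x, τ) ez = fz τ := ⟨_, fun _ => rfl⟩
  obtain ⟨fy, hfy⟩ : ∃ fy : Fin m → ℝ → ℝ, ∀ i τ, v1 (x, τ) (ey i) = fy i τ :=
    ⟨_, fun _ _ => rfl⟩
  obtain ⟨f0, hf0⟩ : ∃ f0 : ℝ → ℝ, ∀ τ, v (x, τ) = f0 τ := ⟨_, fun _ => rfl⟩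
  obtain ⟨fk, hfk⟩ : ∃ fk : ℝ → ℝ, ∀ τ, coeff σ c (x, τ) = fk τ := ⟨_, fun _ => rfl⟩
  simp only [hfz, hfy, hf0, hfk] at *
  fun_prop

set_option maxHeartbeats 800000 in
/-- The Carleman estimate for the conjugated function. -/
lemma carleman (hv : Admissible v v1 v2) {σ : ℝ} (hσ : 10 ≤ σ)
    {c : EuclideanSpace ℝ (Fin m)} (hc : ∀ y : EuclideanSpace ℝ (Fin m), ‖y‖ ≤ 1 →
      121 / 25 ≤ ∑ i, (y i - c i) ^ 2) :
    ∫ r in cyl m (-5) 5, (1 / 50 * energy v1 r + σ ^ 2 * v r ^ 2) ≤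
      (4 * σ)⁻¹ * (∫ r in cyl m (-5) 5,
        (prin v2 r + coeff σ c r * v r + σ * multiplier c v v1 r) ^ 2) +
      ∫ x in unitBall m, (carlemanFlux σ c v v1 (x, -5) - carlemanFlux σ c v v1 (x, 5)) := by
  obtain ⟨W', hW, hW'⟩ := hv.deriv_along (hasFDerivAt_field c) continuous_const
  have hH := (hW.const_mul 2).add (hv.base.const_mul (9 / 10 * m + 2 / 5))
  have hR := ((hv.base.mul hv.base).mul_left (hasFDerivAt_coeff σ c) (continuous_coeff' σ c)).add
    (hv.nullForm.const_mul (-1))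
  have hflux (r : SpaceTime m) : v1 r ez * (2 * v1 r (field c r) + (9 / 10 * m + 2 / 5) * v r)
      + (field c r).2 * (coeff σ c r * (v r * v r) + -1 * PlaneWave.nullForm v1 r)
      = carlemanFlux σ c v v1 r := by
    simp only [carlemanFlux, multiplier]; ring
  obtain ⟨hdi, hfi, hdf⟩ := hv.integral_divergence hH hR (hasFDerivAt_field c) continuous_const
    (D := 9 / 10 * m + 2) (by simp [fieldDeriv_ey, fieldDeriv_ez, fieldDeriv_et]; ring)
    le_rfl le_rfl (by norm_num)
    (fun x hx => by simp only [hflux]; exact hv.continuousOn_carlemanFlux σ c hx)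
  simp only [hflux] at hfi hdf
  set A : SpaceTime m → ℝ :=
    fun r => prin v2 r + coeff σ c r * v r + σ * multiplier c v v1 r with hA
  have hmul : BoundedContinuous (multiplier c v v1) := hH.boundedContinuous
  have hcoeff : BoundedContinuous (coeff σ c) := BoundedContinuous.of_continuous
    (continuous_iff_continuousAt.2 fun r => (hasFDerivAt_coeff σ c r).continuousAt)
  have hAb : BoundedContinuous (fun r => A r ^ 2) :=
    ((hv.boundedContinuous_prin.add (hcoeff.mul hv.base.boundedContinuous)).add
      (hmul.const_mul σ)).pow 2
  have hAi := hAb.integrableOn (a := -5) (b := 5) le_rfl le_rfl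
  have hEi := ((hv.boundedContinuous_energy.const_mul (1 / 50)).add
    ((hv.base.boundedContinuous.pow 2).const_mul (σ ^ 2))).integrableOn (a := -5) (b := 5)
    le_rfl le_rfl
  have key := setIntegral_mono_on (hEi.add hdi) (hAi.const_mul (4 * σ)⁻¹)
    (isOpen_cyl (m := m) (-5) 5).measurableSet ?_
  · rw [integral_add' hEi hdi, hdf, integral_const_mul] at key
    rw [← neg_neg (∫ x in unitBall m, _), ← integral_neg]
    simp only [neg_sub]
    linarith
  · intro r hr
    show 1 / 50 * energy v1 r + σ ^ 2 * v r ^ 2 + (prin v2 r * (multiplier c v v1 r) + _ + _ + _) ≤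
      (4 * σ)⁻¹ * A r ^ 2
    have hs := hv.symm r hr
    have hN : nullForm' v1 v2 r (field c r) =
        2 * v1 r ez * v2 r et (field c r) + 2 * v1 r et * v2 r ez (field c r)
        - 2 * v1 r ez * v2 r ez (field c r) - ∑ i, 2 * v1 r (ey i) * v2 r (ey i) (field c r) := by
      simp [nullForm']
    have hK : coeff' σ c r (field c r) = -4 * σ ^ 2 * (729 / 2000 * ∑ i, (r.1.1 i - c i) ^ 2
        + (2 * r.1.2 + 47 / 100 * r.2) ^ 2 - 47 / 50 * r.1.2 ^ 2) := by
      have : ∑ i, 2 * (r.1.1 i - c i) * (9 / 10 * (r.1.1 i - c i))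
          = 9 / 5 * ∑ i, (r.1.1 i - c i) ^ 2 := by
        rw [Finset.mul_sum]
        exact Finset.sum_congr rfl fun i _ => by ring
      simp [coeff', this]
      ring
    have hsum : ∑ i, v1 r (ey i) * (2 * (v2 r (ey i) (field c r) + v1 r (fieldDeriv (ey i)))
          + (9 / 10 * m + 2 / 5) * v1 r (ey i))
        = ∑ i, 2 * v1 r (ey i) * v2 r (ey i) (field c r)
          + (9 / 5 + (9 / 10 * m + 2 / 5)) * ∑ i, v1 r (ey i) ^ 2 := by
      rw [Finset.mul_sum, ← Finset.sum_add_distrib]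
      refine Finset.sum_congr rfl fun i _ => ?_
      rw [fieldDeriv_ey]
      simp
      ring
    simp only [_root_.add_apply, _root_.smul_apply, smul_eq_mul, hW' r hr, hN, hK, hsum,
      fieldDeriv_ez, fieldDeriv_et, map_sub, map_smul, hA, PlaneWave.nullForm, ← pow_two, energy]
    have hr1 : ‖r.1.1‖ ^ 2 + r.1.2 ^ 2 < 1 := hr.1
    have hr2 : -5 < r.2 ∧ r.2 < 5 := hr.2.1
    have hform := zeroth_form_lower_bound (hc r.1.1 (by nlinarith [norm_nonneg r.1.1]))
      (show r.1.2 ^ 2 ≤ 1 by nlinarith [norm_nonneg r.1.1]) (show r.2 ^ 2 ≤ 25 by nlinarith)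
    have hSn : 0 ≤ ∑ i, v1 r (ey i) ^ 2 := Finset.sum_nonneg fun _ _ => sq_nonneg _
    have hcf : coeff σ c r = -4 * σ ^ 2 * (81 / 400 * ∑ i, (r.1.1 i - c i) ^ 2 + r.1.2 ^ 2
      + 47 / 100 * (r.1.2 * r.2)) + 8 / 5 * σ := rfl
    have hmu : multiplier c v v1 r = 2 * v1 r (field c r) + (9 / 10 * m + 2 / 5) * v r := rfl
    generalize v1 r (field c r) = w at *
    generalize ∑ i, 2 * v1 r (ey i) * v2 r (ey i) (field c r) = s2 at *
    generalize ∑ i, v1 r (ey i) ^ 2 = S at *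
    generalize ∑ i, (r.1.1 i - c i) ^ 2 = Y at *
    generalize multiplier c v v1 r = h at *
    generalize coeff σ c r = k at *
    generalize prin v2 r = P at *
    refine le_trans ?_ (mul_le_inv_mul_sq (by linarith : 0 < σ) (P + k * v r) h)
    have hvv : 0 ≤ v r ^ 2 := sq_nonneg _
    have hlow : σ ^ 2 * v r ^ 2 ≤ 16 * σ ^ 2 * (172125 / 1000000 * Y + 1165 / 1000 * r.1.2 ^ 2
        + 658 / 1000 * (r.1.2 * r.2) + 55225 / 1000000 * r.2 ^ 2) * v r ^ 2
        - 64 / 25 * σ * v r ^ 2 := by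
      rw [← sub_mul]
      exact mul_le_mul_of_nonneg_right (sq_add_le_of_lower_bound hσ hform) hvv
    have hgrad : 1 / 50 * (v1 r ez ^ 2 + S) ≤ 4 * (1 / 20 * S
        + (v1 r et - 3 / 5 * v1 r ez) ^ 2 + 1 / 200 * v1 r ez ^ 2) := by
      linarith [sq_nonneg (v1 r et - 3 / 5 * v1 r ez)]
    refine le_trans (add_le_add_left (add_le_add hgrad hlow) _) (le_of_eq ?_)
    subst hcf hmu
    ring

end Admissible

/-- The exponent of the Carleman weight. -/
noncomputable def weight (c : EuclideanSpace ℝ (Fin m)) (r : SpaceTime m) : ℝ :=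
  9 / 20 * ∑ i, (r.1.1 i - c i) ^ 2 + r.1.2 ^ 2 - 47 / 200 * r.2 ^ 2

/-- The second derivative of `weight`. -/
noncomputable def weight2 (e : SpaceTime m) : SpaceTime m →L[ℝ] ℝ :=
  ∑ i, (9 / 10 * e.1.1 i) • coordY i + (2 * e.1.2) • coordZ - (47 / 100 * e.2) • coordT

/-- The derivative of `weight`. -/
noncomputable def weight1 (c : EuclideanSpace ℝ (Fin m)) (r : SpaceTime m) :
    SpaceTime m →L[ℝ] ℝ :=
  weight2 (r - ((c, 0), 0))

lemma weight2_apply (e ξ : SpaceTime m) : weight2 e ξ =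
    9 / 10 * ∑ i, e.1.1 i * ξ.1.1 i + 2 * e.1.2 * ξ.1.2 - 47 / 100 * e.2 * ξ.2 := by
  simp [weight2, Finset.mul_sum, mul_assoc]

lemma weight2_symm (e ξ : SpaceTime m) : weight2 e ξ = weight2 ξ e := by
  simp only [weight2_apply, mul_comm (ξ.1.1 _)]
  ring

lemma weight1_apply (c : EuclideanSpace ℝ (Fin m)) (r ξ : SpaceTime m) :
    weight1 c r ξ = weight2 ξ r - weight2 ξ ((c, 0), 0) := by
  rw [weight1, weight2_symm, map_sub]

lemma hasFDerivAt_weight (c : EuclideanSpace ℝ (Fin m)) (r : SpaceTime m) :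
    HasFDerivAt (weight c) (weight1 c r) r := by
  have hz : HasFDerivAt (fun r : SpaceTime m => r.1.2) coordZ r := coordZ.hasFDerivAt
  have ht : HasFDerivAt (fun r : SpaceTime m => r.2) coordT r := coordT.hasFDerivAt
  refine ((((hasFDerivAt_sum_sq c r).const_mul (9 / 20 : ℝ)).add (hz.pow 2)).sub
    ((ht.pow 2).const_mul (47 / 200 : ℝ))).congr_fderiv ?_
  refine ContinuousLinearMap.ext fun ξ => ?_
  simp only [weight1, weight2_apply]
  simp [Finset.mul_sum]
  ring_nf

lemma hasFDerivAt_weight1 (c : EuclideanSpace ℝ (Fin m)) (e r : SpaceTime m) :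
    HasFDerivAt (fun r => weight1 c r e) (weight2 e) r := by
  simp only [weight1_apply]
  exact (weight2 e).hasFDerivAt.sub_const _

lemma continuous_weight1 (c : EuclideanSpace ℝ (Fin m)) : Continuous (weight1 c) := by
  unfold weight1 weight2
  simp only [Prod.fst_sub, Prod.snd_sub, PiLp.sub_apply]
  fun_prop

/-- The Carleman weight function. -/
noncomputable def expWeight (σ : ℝ) (c : EuclideanSpace ℝ (Fin m)) (r : SpaceTime m) : ℝ :=
  Real.exp (σ * weight c r)

lemma hasFDerivAt_expWeight (σ : ℝ) (c : EuclideanSpace ℝ (Fin m)) (r : SpaceTime m) :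
    HasFDerivAt (expWeight σ c) ((σ * expWeight σ c r) • weight1 c r) r := by
  refine ((hasFDerivAt_weight c r).const_mul σ).exp.congr_fderiv ?_
  rw [smul_smul, mul_comm]
  rfl

lemma continuous_expWeight (σ : ℝ) (c : EuclideanSpace ℝ (Fin m)) : Continuous (expWeight σ c) :=
  continuous_iff_continuousAt.2 fun r => (hasFDerivAt_expWeight σ c r).continuousAt

lemma expWeight_pos (σ : ℝ) (c : EuclideanSpace ℝ (Fin m)) (r : SpaceTime m) :
    0 < expWeight σ c r := Real.exp_pos _

lemma hasFDerivAt_expWeight1 (σ : ℝ) (c : EuclideanSpace ℝ (Fin m)) (e r : SpaceTime m) :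
    HasFDerivAt (fun r => ((σ * expWeight σ c r) • weight1 c r) e)
      ((σ * expWeight σ c r) • (weight2 e + (σ * weight1 c r e) • weight1 c r)) r := by
  refine (((hasFDerivAt_expWeight σ c r).const_mul σ).mul
    (hasFDerivAt_weight1 c e r)).congr_fderiv ?_
  refine ContinuousLinearMap.ext fun ξ => ?_
  simp
  ring

/-- The derivative of the product of `u` with the Carleman weight. -/
noncomputable def conj1 (σ : ℝ) (c : EuclideanSpace ℝ (Fin m)) (u : SpaceTime m → ℝ)
    (u1 : SpaceTime m → SpaceTime m →L[ℝ] ℝ) (r : SpaceTime m) : SpaceTime m →L[ℝ] ℝ :=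
  expWeight σ c r • u1 r + u r • ((σ * expWeight σ c r) • weight1 c r)

/-- The second derivative of the product of `u` with the Carleman weight. -/
noncomputable def conj2 (σ : ℝ) (c : EuclideanSpace ℝ (Fin m)) (u : SpaceTime m → ℝ)
    (u1 : SpaceTime m → SpaceTime m →L[ℝ] ℝ)
    (u2 : SpaceTime m → SpaceTime m → SpaceTime m →L[ℝ] ℝ) (r e : SpaceTime m) :
    SpaceTime m →L[ℝ] ℝ :=
  expWeight σ c r • u2 r e + u1 r e • ((σ * expWeight σ c r) • weight1 c r)
    + (((σ * expWeight σ c r) • weight1 c r) e • u1 r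
      + u r • ((σ * expWeight σ c r) • (weight2 e + (σ * weight1 c r e) • weight1 c r)))

lemma conj1_apply (σ : ℝ) (c : EuclideanSpace ℝ (Fin m)) (u : SpaceTime m → ℝ)
    (u1 : SpaceTime m → SpaceTime m →L[ℝ] ℝ) (r ξ : SpaceTime m) :
    conj1 σ c u u1 r ξ = expWeight σ c r * (u1 r ξ + σ * u r * weight1 c r ξ) := by
  simp [conj1]
  ring

@[simp] lemma weight1_ey (c : EuclideanSpace ℝ (Fin m)) (r : SpaceTime m) (i : Fin m) :
    weight1 c r (ey i) = 9 / 10 * (r.1.1 i - c i) := by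
  simp [weight1, weight2_apply]

@[simp] lemma weight1_ez (c : EuclideanSpace ℝ (Fin m)) (r : SpaceTime m) :
    weight1 c r ez = 2 * r.1.2 := by
  simp [weight1, weight2_apply]

@[simp] lemma weight1_et (c : EuclideanSpace ℝ (Fin m)) (r : SpaceTime m) :
    weight1 c r et = -(47 / 100 * r.2) := by
  simp [weight1, weight2_apply]

/-- Conjugation of the principal part by the Carleman weight. -/
lemma conjugated_operator (σ : ℝ) (c : EuclideanSpace ℝ (Fin m)) (u : SpaceTime m → ℝ)
    (u1 : SpaceTime m → SpaceTime m →L[ℝ] ℝ)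
    (u2 : SpaceTime m → SpaceTime m → SpaceTime m →L[ℝ] ℝ) (r : SpaceTime m) :
    prin (conj2 σ c u u1 u2) r + coeff σ c r * (expWeight σ c r * u r)
      + σ * multiplier c (fun r => expWeight σ c r * u r) (conj1 σ c u u1) r
      = expWeight σ c r * prin u2 r := by
  have h1 : ∑ i, conj2 σ c u u1 u2 r (ey i) (ey i) = expWeight σ c r *
      (∑ i, u2 r (ey i) (ey i) + 9 / 5 * σ * ∑ i, (r.1.1 i - c i) * u1 r (ey i)
        + u r * (σ * (9 / 10 * m) + 81 / 100 * σ ^ 2 * ∑ i, (r.1.1 i - c i) ^ 2)) := by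
    have (i : Fin m) : conj2 σ c u u1 u2 r (ey i) (ey i) = expWeight σ c r * (u2 r (ey i) (ey i)) +
        expWeight σ c r * (9 / 5 * σ * ((r.1.1 i - c i) * u1 r (ey i))) +
        expWeight σ c r * u r * σ * (9 / 10) +
        expWeight σ c r * u r * (81 / 100 * σ ^ 2) * (r.1.1 i - c i) ^ 2 := by
      simp [conj2, weight2_apply]
      ring
    simp only [this, Finset.sum_add_distrib, ← Finset.mul_sum, Finset.sum_const, Finset.card_univ,
      Fintype.card_fin, nsmul_eq_mul]
    ring
  have h2 : conj1 σ c u u1 r (field c r) = expWeight σ c r *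
      (9 / 10 * ∑ i, (r.1.1 i - c i) * u1 r (ey i) + (2 * r.1.2 + 47 / 100 * r.2) * u1 r ez
        - 2 * r.1.2 * u1 r et + σ * u r * (81 / 100 * ∑ i, (r.1.1 i - c i) ^ 2
        + (2 * r.1.2 + 47 / 100 * r.2) * (2 * r.1.2) + 47 / 50 * r.1.2 * r.2)) := by
    rw [conj1_apply, linear_eq_sum (u1 r), linear_eq_sum (weight1 c r)]
    have e1 : ∑ i, (field c r).1.1 i * u1 r (ey i)
        = 9 / 10 * ∑ i, (r.1.1 i - c i) * u1 r (ey i) := by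
      rw [Finset.mul_sum]
      exact Finset.sum_congr rfl fun i _ => by simp; ring
    have e2 : ∑ i, (field c r).1.1 i * weight1 c r (ey i)
        = 81 / 100 * ∑ i, (r.1.1 i - c i) ^ 2 := by
      rw [Finset.mul_sum]
      exact Finset.sum_congr rfl fun i _ => by simp; ring
    rw [e1, e2]
    simp only [field_z, field_t, weight1_ez, weight1_et]
    ring
  rw [prin, h1, multiplier, h2, prin, coeff]
  simp [conj2, weight2_apply]
  ring

lemma sum_sq_eq_norm (y c : EuclideanSpace ℝ (Fin m)) :
    ∑ i, (y i - c i) ^ 2 = ‖y - c‖ ^ 2 := by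
  simp [EuclideanSpace.real_norm_sq_eq]

lemma sum_sq_lower_bound {y c : EuclideanSpace ℝ (Fin m)} (hc : ‖c‖ = 16 / 5) (hy : ‖y‖ ≤ 1) :
    121 / 25 ≤ ∑ i, (y i - c i) ^ 2 := by
  rw [sum_sq_eq_norm]
  have := norm_sub_norm_le c y
  rw [norm_sub_rev] at this
  nlinarith

lemma sum_sq_upper_bound {y c : EuclideanSpace ℝ (Fin m)} (hc : ‖c‖ = 16 / 5) :
    ∑ i, (y i - c i) ^ 2 ≤ (‖y‖ + 16 / 5) ^ 2 := by
  rw [sum_sq_eq_norm]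
  have := norm_sub_le y c
  rw [hc] at this
  exact pow_le_pow_left₀ (norm_nonneg _) this 2

lemma weight_lower_bound {c : EuclideanSpace ℝ (Fin m)} (hc : ‖c‖ = 16 / 5) {x : Space m}
    (hx : x ∈ unitBall m) : 2178 / 1000 ≤ weight c (x, 0) := by
  have hx : ‖x.1‖ ^ 2 + x.2 ^ 2 < 1 := hx
  have := sum_sq_lower_bound hc (by nlinarith [norm_nonneg x.1, sq_nonneg x.2] : ‖x.1‖ ≤ 1)
  simp only [weight]
  nlinarith [sq_nonneg x.2]

lemma weight_upper_bound {c : EuclideanSpace ℝ (Fin m)} (hc : ‖c‖ = 16 / 5) {x : Space m}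
    (hx : x ∈ unitBall m) {τ : ℝ} (hτ : τ ^ 2 = 25) : weight c (x, τ) ≤ 2063 / 1000 := by
  have hx : ‖x.1‖ ^ 2 + x.2 ^ 2 < 1 := hx
  have h1 : ‖x.1‖ ≤ 1 := by nlinarith [norm_nonneg x.1, sq_nonneg x.2]
  have := sum_sq_upper_bound hc (y := x.1)
  simp only [weight, hτ]
  nlinarith [norm_nonneg x.1]

namespace Admissible

variable {u : SpaceTime m → ℝ} {u1 : SpaceTime m → SpaceTime m →L[ℝ] ℝ}
  {u2 : SpaceTime m → SpaceTime m → SpaceTime m →L[ℝ] ℝ}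

lemma conj (hu : Admissible u u1 u2) (σ : ℝ) (c : EuclideanSpace ℝ (Fin m)) :
    Admissible (fun r => expWeight σ c r * u r) (conj1 σ c u u1) (conj2 σ c u u1 u2) := by
  have h1 : Continuous fun r => (σ * expWeight σ c r) :=
    continuous_const.mul (continuous_expWeight σ c)
  refine hu.mul_smooth (hasFDerivAt_expWeight σ c) (hasFDerivAt_expWeight1 σ c)
    (h1.smul (continuous_weight1 c)) (fun e => ?_) (fun r e ξ => ?_)
  · have h2 : Continuous fun r => weight1 c r e := (continuous_weight1 c).clm_apply continuous_const
    exact h1.smul (continuous_const.add ((continuous_const.mul h2).smul (continuous_weight1 c)))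
  · simp only [_root_.add_apply, _root_.smul_apply, smul_eq_mul, weight2_symm e ξ]
    ring

end Admissible

/-- The weighted energy is controlled by the energy of the conjugated function. -/
lemma energy_conj_lower_bound (u : SpaceTime m → ℝ) (u1 : SpaceTime m → SpaceTime m →L[ℝ] ℝ)
    {σ : ℝ} {c : EuclideanSpace ℝ (Fin m)} (hc : ‖c‖ = 16 / 5) {r : SpaceTime m}
    (hr : r.1 ∈ unitBall m) :
    1 / 100 * (expWeight σ c r ^ 2 * (energy u1 r + σ ^ 2 * u r ^ 2)) ≤
      1 / 50 * energy (conj1 σ c u u1) r + σ ^ 2 * (expWeight σ c r * u r) ^ 2 := by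
  have hx : ‖r.1.1‖ ^ 2 + r.1.2 ^ 2 < 1 := hr
  have h1 : ‖r.1.1‖ ≤ 1 := by nlinarith [norm_nonneg r.1.1, sq_nonneg r.1.2]
  have hY : ∑ i, (r.1.1 i - c i) ^ 2 ≤ 441 / 25 := by
    nlinarith [sum_sq_upper_bound hc (y := r.1.1), norm_nonneg r.1.1]
  have key (a b : ℝ) : a ^ 2 ≤ 2 * (a + b) ^ 2 + 2 * b ^ 2 := by
    nlinarith [sq_nonneg (a + 2 * b)]
  have hz := key (u1 r ez) (σ * u r * weight1 c r ez)
  have hy : ∑ i, u1 r (ey i) ^ 2 ≤ 2 * ∑ i, (u1 r (ey i) + σ * u r * weight1 c r (ey i)) ^ 2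
      + 81 / 50 * (σ ^ 2 * u r ^ 2) * ∑ i, (r.1.1 i - c i) ^ 2 := by
    rw [Finset.mul_sum, Finset.mul_sum, ← Finset.sum_add_distrib]
    refine Finset.sum_le_sum fun i _ => (key _ (σ * u r * weight1 c r (ey i))).trans (le_of_eq ?_)
    simp
    ring
  have he : energy (conj1 σ c u u1) r = expWeight σ c r ^ 2 *
      ((u1 r ez + σ * u r * weight1 c r ez) ^ 2
        + ∑ i, (u1 r (ey i) + σ * u r * weight1 c r (ey i)) ^ 2) := by
    simp only [energy, conj1_apply, mul_pow, ← Finset.mul_sum]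
    ring
  have hE : energy u1 r = u1 r ez ^ 2 + ∑ i, u1 r (ey i) ^ 2 := rfl
  rw [he, hE, mul_pow, mul_left_comm (1 / 100 : ℝ), mul_left_comm (1 / 50 : ℝ),
    mul_left_comm (σ ^ 2), ← mul_add]
  refine mul_le_mul_of_nonneg_left ?_ (sq_nonneg _)
  have hn : 0 ≤ σ ^ 2 * u r ^ 2 := by positivity
  have h5 := mul_le_mul_of_nonneg_left hY hn
  have h6 : (σ * u r * weight1 c r ez) ^ 2 ≤ 4 * (σ ^ 2 * u r ^ 2) := by
    rw [weight1_ez]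
    nlinarith [norm_nonneg r.1.1]
  linarith

lemma norm_ey (i : Fin m) : ‖(ey i : SpaceTime m)‖ = 1 := by simp [ey, Prod.norm_def]

lemma norm_ez : ‖(ez : SpaceTime m)‖ = 1 := by simp [ez, Prod.norm_def]

lemma abs_apply_le {ℓ : SpaceTime m →L[ℝ] ℝ} {M : ℝ} (hℓ : ‖ℓ‖ ≤ M) {e : SpaceTime m}
    (he : ‖e‖ = 1) : |ℓ e| ≤ M := by
  have := ℓ.le_opNorm e
  rw [he, mul_one] at this
  exact this.trans hℓ

lemma sum_sq_le {c : EuclideanSpace ℝ (Fin m)} (hc : ‖c‖ = 16 / 5) {x : Space m}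
    (hx : x ∈ unitBall m) : ∑ i, (x.1 i - c i) ^ 2 ≤ 441 / 25 := by
  have hx : ‖x.1‖ ^ 2 + x.2 ^ 2 < 1 := hx
  have h1 : ‖x.1‖ ≤ 1 := by nlinarith [norm_nonneg x.1, sq_nonneg x.2]
  nlinarith [sum_sq_upper_bound hc (y := x.1), norm_nonneg x.1]

lemma abs_coord_sub_le {c : EuclideanSpace ℝ (Fin m)} (hc : ‖c‖ = 16 / 5) {x : Space m}
    (hx : x ∈ unitBall m) (i : Fin m) : |x.1 i - c i| ≤ 21 / 5 := by
  refine abs_le_of_sq_le_sq ?_ (by norm_num)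
  refine (Finset.single_le_sum (f := fun i => (x.1 i - c i) ^ 2) (fun _ _ => sq_nonneg _)
    (Finset.mem_univ i)).trans ((sum_sq_le hc hx).trans (by norm_num))

lemma abs_snd_le {x : Space m} (hx : x ∈ unitBall m) : |x.2| ≤ 1 := by
  have hx : ‖x.1‖ ^ 2 + x.2 ^ 2 < 1 := hx
  refine abs_le_of_sq_le_sq ?_ zero_le_one
  nlinarith [sq_nonneg ‖x.1‖]

lemma abs_coeff_le {σ : ℝ} (hσ : 10 ≤ σ) {c : EuclideanSpace ℝ (Fin m)} (hc : ‖c‖ = 16 / 5)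
    {x : Space m} (hx : x ∈ unitBall m) {τ : ℝ} (hτ : |τ| ≤ 5) :
    |coeff σ c (x, τ)| ≤ 28 * σ ^ 2 := by
  have h1 := sum_sq_le hc hx
  have h2 : 0 ≤ ∑ i, (x.1 i - c i) ^ 2 := Finset.sum_nonneg fun _ _ => sq_nonneg _
  have h3 : |x.2 * τ| ≤ 5 := by
    rw [abs_mul]
    nlinarith [abs_snd_le hx, abs_nonneg x.2, abs_nonneg τ]
  have h4 : x.2 ^ 2 ≤ 1 := by rw [← sq_abs]; nlinarith [abs_snd_le hx, abs_nonneg x.2]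
  have h5 : |81 / 400 * ∑ i, (x.1 i - c i) ^ 2 + x.2 ^ 2 + 47 / 100 * (x.2 * τ)| ≤ 693 / 100 := by
    rw [abs_le] at h3 ⊢
    constructor <;> nlinarith [sq_nonneg x.2]
  simp only [coeff]
  rw [abs_le] at h5 ⊢
  constructor <;> nlinarith [sq_nonneg σ]

lemma abs_carlemanFlux_le {σ : ℝ} (hσ : 10 ≤ σ) {c : EuclideanSpace ℝ (Fin m)}
    (hc : ‖c‖ = 16 / 5) {x : Space m} (hx : x ∈ unitBall m) {τ : ℝ} (hτ : |τ| ≤ 5)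
    {v : SpaceTime m → ℝ} {v1 : SpaceTime m → SpaceTime m →L[ℝ] ℝ} {N : ℝ}
    (h0 : |v (x, τ)| ≤ N) (hz : |v1 (x, τ) ez| ≤ N) (hy : ∀ i, |v1 (x, τ) (ey i)| ≤ N) :
    |carlemanFlux σ c v v1 (x, τ)| ≤ (60 + 11 * m) * σ ^ 2 * N ^ 2 := by
  have hN : 0 ≤ N := (abs_nonneg _).trans h0
  rw [carlemanFlux_eq, energy]
  have hsq {a : ℝ} (ha : |a| ≤ N) : a ^ 2 ≤ N ^ 2 := by
    rw [← sq_abs]; exact pow_le_pow_left₀ (abs_nonneg _) ha 2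
  have hm : (0 : ℝ) ≤ m := Nat.cast_nonneg m
  have s1 : |∑ i, (x.1 i - c i) * v1 (x, τ) (ey i)| ≤ m * (21 / 5 * N) := by
    refine (Finset.abs_sum_le_sum_abs _ _).trans ((Finset.sum_le_card_nsmul _ _ (21 / 5 * N)
      fun i _ => ?_).trans (le_of_eq (by simp)))
    rw [abs_mul]
    exact mul_le_mul (abs_coord_sub_le hc hx i) (hy i) (abs_nonneg _) (by norm_num)
  have s2 : |∑ i, v1 (x, τ) (ey i) ^ 2| ≤ m * N ^ 2 := by
    rw [abs_of_nonneg (Finset.sum_nonneg fun _ _ => sq_nonneg _)]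
    exact (Finset.sum_le_card_nsmul _ _ (N ^ 2) fun i _ => hsq (hy i)).trans
      (le_of_eq (by simp))
  have hk := abs_coeff_le hσ hc hx hτ
  have h2 : |2 * x.2 + 47 / 100 * τ| ≤ 435 / 100 := by
    have := abs_snd_le hx
    rw [abs_le] at *
    constructor <;> linarith
  have t1 : |2 * v1 (x, τ) ez * (9 / 10 * ∑ i, (x.1 i - c i) * v1 (x, τ) (ey i)
        + (2 * x.2 + 47 / 100 * τ) * v1 (x, τ) ez)|
      ≤ 2 * N * (9 / 10 * (m * (21 / 5 * N)) + 435 / 100 * N) := by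
    rw [abs_mul]
    refine mul_le_mul ?_ ((abs_add_le _ _).trans (add_le_add ?_ ?_)) (abs_nonneg _) (by positivity)
    · rw [abs_mul, abs_two]; linarith
    · rw [abs_mul, abs_of_pos (by norm_num : (0 : ℝ) < 9 / 10)]; linarith
    · rw [abs_mul]; exact mul_le_mul h2 hz (abs_nonneg _) (by norm_num)
  have t2 : |(9 / 10 * m + 2 / 5) * (v (x, τ) * v1 (x, τ) ez)|
      ≤ (9 / 10 * m + 2 / 5) * (N * N) := by
    rw [abs_mul, abs_of_nonneg (by positivity), abs_mul]
    exact mul_le_mul_of_nonneg_left (mul_le_mul h0 hz (abs_nonneg _) hN) (by positivity)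
  have t3 : |2 * x.2 * (coeff σ c (x, τ) * v (x, τ) ^ 2
        + (v1 (x, τ) ez ^ 2 + ∑ i, v1 (x, τ) (ey i) ^ 2))|
      ≤ 2 * (28 * σ ^ 2 * N ^ 2 + (N ^ 2 + m * N ^ 2)) := by
    rw [abs_mul]
    refine mul_le_mul ?_ ((abs_add_le _ _).trans (add_le_add ?_
      ((abs_add_le _ _).trans (add_le_add ?_ s2)))) (abs_nonneg _) (by positivity)
    · rw [abs_mul, abs_two]; linarith [abs_snd_le hx]
    · rw [abs_mul, abs_of_nonneg (sq_nonneg (v (x, τ)))]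
      exact mul_le_mul hk (hsq h0) (sq_nonneg _) (by positivity)
    · rw [abs_of_nonneg (sq_nonneg _)]; exact hsq hz
  refine (abs_sub _ _).trans ((add_le_add ((abs_add_le _ _).trans (add_le_add t1 t2)) t3).trans ?_)
  have hs : (100 : ℝ) ≤ σ ^ 2 := by nlinarith
  have hN2 : 0 ≤ N ^ 2 := sq_nonneg N
  have a1 : 100 * N ^ 2 ≤ σ ^ 2 * N ^ 2 := mul_le_mul_of_nonneg_right hs hN2
  have a2 : m * (100 * N ^ 2) ≤ m * (σ ^ 2 * N ^ 2) := mul_le_mul_of_nonneg_left a1 hm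
  nlinarith [mul_nonneg hm hN2]

lemma abs_carlemanFlux_conj_le {σ : ℝ} (hσ : 10 ≤ σ) {c : EuclideanSpace ℝ (Fin m)}
    (hc : ‖c‖ = 16 / 5) {x : Space m} (hx : x ∈ unitBall m) {τ : ℝ} (hτ : τ ^ 2 = 25)
    {u : SpaceTime m → ℝ} {u1 : SpaceTime m → SpaceTime m →L[ℝ] ℝ} {M : ℝ}
    (h0 : |u (x, τ)| ≤ M) (h1 : ‖u1 (x, τ)‖ ≤ M) :
    |carlemanFlux σ c (fun r => expWeight σ c r * u r) (conj1 σ c u u1) (x, τ)|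
      ≤ 25 * (60 + 11 * m) * M ^ 2 * σ ^ 4 * Real.exp (2 * σ * (2063 / 1000)) := by
  have hM : 0 ≤ M := (abs_nonneg _).trans h0
  set w := expWeight σ c (x, τ) with hw
  have hw0 : 0 < w := expWeight_pos _ _ _
  have hτ5 : |τ| ≤ 5 := abs_le_of_sq_le_sq (by linarith) (by norm_num)
  have hbd (e : SpaceTime m) (he : ‖e‖ = 1) (hwe : |weight1 c (x, τ) e| ≤ 4) :
      |conj1 σ c u u1 (x, τ) e| ≤ 5 * σ * M * w := by
    rw [conj1_apply, abs_mul, abs_of_pos (expWeight_pos _ _ _), mul_comm]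
    refine mul_le_mul_of_nonneg_right ((abs_add_le _ _).trans ?_) hw0.le
    rw [abs_mul, abs_mul, abs_of_pos (by linarith : 0 < σ)]
    have e1 := abs_apply_le h1 he
    have e2 : σ * |u (x, τ)| * |weight1 c (x, τ) e| ≤ σ * M * 4 :=
      mul_le_mul (mul_le_mul_of_nonneg_left h0 (by linarith)) hwe (abs_nonneg _)
        (mul_nonneg (by linarith) hM)
    nlinarith
  refine (abs_carlemanFlux_le hσ hc hx hτ5 (N := 5 * σ * M * w) ?_
    (hbd ez norm_ez ?_) (fun i => hbd _ (norm_ey i) ?_)).trans ?_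
  · rw [abs_mul, abs_of_pos (expWeight_pos _ _ _), mul_comm]
    refine mul_le_mul_of_nonneg_right (h0.trans ?_) hw0.le
    nlinarith
  · rw [weight1_ez, abs_mul, abs_two]
    linarith [abs_snd_le hx]
  · rw [weight1_ey, abs_mul, abs_of_pos (by norm_num : (0 : ℝ) < 9 / 10)]
    linarith [abs_coord_sub_le hc hx i]
  · have hexp : w ^ 2 ≤ Real.exp (2 * σ * (2063 / 1000)) := by
      rw [hw, expWeight, ← Real.exp_nat_mul]
      refine Real.exp_le_exp.2 ?_
      have := mul_le_mul_of_nonneg_left (weight_upper_bound hc hx hτ) (by linarith : 0 ≤ σ)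
      push_cast
      linarith
    calc (60 + 11 * (m : ℝ)) * σ ^ 2 * (5 * σ * M * w) ^ 2
        = 25 * (60 + 11 * m) * M ^ 2 * σ ^ 4 * w ^ 2 := by ring
      _ ≤ _ := mul_le_mul_of_nonneg_left hexp (by positivity)

lemma expWeight_sq (σ : ℝ) (c : EuclideanSpace ℝ (Fin m)) (r : SpaceTime m) :
    expWeight σ c r ^ 2 = expWeight (2 * σ) c r := by
  rw [expWeight, expWeight, ← Real.exp_nat_mul]
  congr 1
  push_cast
  ring

lemma abs_cross_terms_le {σ : ℝ} (hσ : 10 ≤ σ) {c : EuclideanSpace ℝ (Fin m)}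
    (hc : ‖c‖ = 16 / 5) {x : Space m} (hx : x ∈ unitBall m) {τ : ℝ} (hτ : |τ| ≤ 5)
    (a P : ℝ) (b : Fin m → ℝ) :
    |a * P + 2 * σ * (-(a * (9 / 10 * ∑ i, (x.1 i - c i) * b i)) - x.2 * a ^ 2
      - 47 / 100 * τ * a ^ 2 + x.2 * ∑ i, b i ^ 2)|
    ≤ 20 * σ * (a ^ 2 + ∑ i, b i ^ 2) + P ^ 2 := by
  have hcs := Finset.sum_mul_sq_le_sq_mul_sq Finset.univ (fun i => x.1 i - c i) b
  have hS : 0 ≤ ∑ i, b i ^ 2 := Finset.sum_nonneg fun _ _ => sq_nonneg _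
  have hcs := hcs.trans (mul_le_mul_of_nonneg_right (sum_sq_le hc hx) hS)
  generalize ∑ i, (x.1 i - c i) * b i = B at *
  generalize ∑ i, b i ^ 2 = S at *
  have h1 : |a * (9 / 10 * B)| ≤ a ^ 2 / 2 + 8 * S := by
    rw [abs_le]
    constructor <;> nlinarith [sq_nonneg (a + 9 / 10 * B), sq_nonneg (a - 9 / 10 * B)]
  have h2 : |x.2 * a ^ 2| ≤ a ^ 2 := by
    rw [abs_mul, abs_of_nonneg (sq_nonneg a)]
    nlinarith [abs_snd_le hx, sq_nonneg a]
  have h3 : |47 / 100 * τ * a ^ 2| ≤ 235 / 100 * a ^ 2 := by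
    rw [abs_mul, abs_of_nonneg (sq_nonneg a), abs_mul,
      abs_of_pos (by norm_num : (0 : ℝ) < 47 / 100)]
    nlinarith [sq_nonneg a]
  have h4 : |x.2 * S| ≤ S := by
    rw [abs_mul, abs_of_nonneg hS]
    nlinarith [abs_snd_le hx]
  have h5 : |-(a * (9 / 10 * B)) - x.2 * a ^ 2 - 47 / 100 * τ * a ^ 2 + x.2 * S|
      ≤ 9 * (a ^ 2 + S) := by
    rw [abs_le] at *
    have := sq_nonneg a
    constructor <;> linarith
  have h6 : |a * P| ≤ a ^ 2 + P ^ 2 := by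
    rw [abs_le]
    constructor <;> nlinarith [sq_nonneg (a + P), sq_nonneg (a - P)]
  refine (abs_add_le _ _).trans ?_
  rw [abs_mul (2 * σ), abs_of_pos (by linarith : 0 < 2 * σ)]
  have h7 := mul_le_mul_of_nonneg_left h5 (by linarith : 0 ≤ 2 * σ)
  have h8 : a ^ 2 + S ≤ 2 * σ * (a ^ 2 + S) := by
    nlinarith [sq_nonneg a]
  linarith

namespace Admissible

variable {u : SpaceTime m → ℝ} {u1 : SpaceTime m → SpaceTime m →L[ℝ] ℝ}
  {u2 : SpaceTime m → SpaceTime m → SpaceTime m →L[ℝ] ℝ}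

lemma boundedContinuous_expWeight_sq_mul {σ : ℝ} {c : EuclideanSpace ℝ (Fin m)}
    {f : SpaceTime m → ℝ} (hf : BoundedContinuous f) :
    BoundedContinuous (fun r => expWeight σ c r ^ 2 * f r) :=
  ((BoundedContinuous.of_continuous (continuous_expWeight σ c)).pow 2).mul hf

/-- The Carleman estimate. -/
lemma weighted_energy_le (hu : Admissible u u1 u2) {c : EuclideanSpace ℝ (Fin m)}
    (hc : ‖c‖ = 16 / 5) {M : ℝ}
    (hM : ∀ r ∈ unitBall m ×ˢ Icc (-5 : ℝ) 5, |u r| ≤ M ∧ ‖u1 r‖ ≤ M) :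
    ∃ C, 0 ≤ C ∧ ∀ σ, 10 ≤ σ →
      ∫ r in cyl m (-5) 5, expWeight σ c r ^ 2 * (energy u1 r + σ ^ 2 * u r ^ 2) ≤
        25 / σ * (∫ r in cyl m (-5) 5, expWeight σ c r ^ 2 * prin u2 r ^ 2)
        + C * (σ ^ 4 * Real.exp (2 * σ * (2063 / 1000))) := by
  refine ⟨200 * (25 * (60 + 11 * m) * M ^ 2) * volume.real (unitBall m), by positivity,
    fun σ hσ => ?_⟩
  have hcar := (hu.conj σ c).carleman hσ (fun y hy => sum_sq_lower_bound hc hy)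
  simp only [conjugated_operator, mul_pow (expWeight σ c _) (prin u2 _)] at hcar
  have hms := (isOpen_cyl (m := m) (-5) 5).measurableSet
  have hi1 := (boundedContinuous_expWeight_sq_mul (σ := σ) (c := c)
    (hu.boundedContinuous_energy.add ((hu.base.boundedContinuous.pow 2).const_mul
      (σ ^ 2)))).integrableOn (a := -5) (b := 5) le_rfl le_rfl
  have hi2 := (((hu.conj σ c).boundedContinuous_energy.const_mul (1 / 50)).add
    (((hu.conj σ c).base.boundedContinuous.pow 2).const_mul (σ ^ 2))).integrableOn
    (a := -5) (b := 5) le_rfl le_rfl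
  have hlow := setIntegral_mono_on (hi1.const_mul (1 / 100)) hi2 hms
    fun r hr => energy_conj_lower_bound u u1 hc hr.1
  rw [integral_const_mul] at hlow
  have hfl : ∫ x in unitBall m,
      (carlemanFlux σ c (fun r => expWeight σ c r * u r) (conj1 σ c u u1) (x, -5)
        - carlemanFlux σ c (fun r => expWeight σ c r * u r) (conj1 σ c u u1) (x, 5))
      ≤ 2 * (25 * (60 + 11 * m) * M ^ 2 * σ ^ 4 * Real.exp (2 * σ * (2063 / 1000)))
        * volume.real (unitBall m) := by
    refine (Real.le_norm_self _).trans (norm_setIntegral_le_of_norm_le_const volume_unitBall_lt_top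
      fun x hx => ?_)
    have b1 := hM (x, -5) ⟨hx, by norm_num⟩
    have b2 := hM (x, 5) ⟨hx, by norm_num⟩
    have := abs_carlemanFlux_conj_le hσ hc hx (by norm_num) b1.1 b1.2
    have := abs_carlemanFlux_conj_le hσ hc hx (by norm_num) b2.1 b2.2
    refine (abs_sub _ _).trans ?_
    linarith
  have e : 25 / σ = 100 * (4 * σ)⁻¹ := by field_simp; norm_num
  rw [e]
  linarith

/-- Integration by parts against `∂_z u` on the upper half of the cylinder. -/
lemma trace_le (hu : Admissible u u1 u2) {c : EuclideanSpace ℝ (Fin m)}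
    (hc : ‖c‖ = 16 / 5) {M : ℝ}
    (hM : ∀ r ∈ unitBall m ×ˢ Icc (-5 : ℝ) 5, |u r| ≤ M ∧ ‖u1 r‖ ≤ M) :
    ∃ C, 0 ≤ C ∧ ∀ σ, 10 ≤ σ →
      ∫ x in unitBall m, expWeight σ c (x, 0) ^ 2 * u1 (x, 0) ez ^ 2 ≤
        (∫ r in cyl m (-5) 5, expWeight σ c r ^ 2 * (20 * σ * energy u1 r + prin u2 r ^ 2))
        + C * Real.exp (2 * σ * (2063 / 1000)) := by
  refine ⟨M ^ 2 * volume.real (unitBall m), by positivity, fun σ hσ => ?_⟩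
  have hH := (hu.deriv ez).mul_left (hasFDerivAt_expWeight (2 * σ) c)
    ((continuous_const.mul (continuous_expWeight (2 * σ) c)).smul (continuous_weight1 c))
  have hR := (hu.nullForm.const_mul (-(1 / 2))).mul_left (hasFDerivAt_expWeight (2 * σ) c)
    ((continuous_const.mul (continuous_expWeight (2 * σ) c)).smul (continuous_weight1 c))
  have hflux (r : SpaceTime m) (R : ℝ) : u1 r ez * (expWeight (2 * σ) c r * u1 r ez)
      + (ez : SpaceTime m).2 * R = expWeight σ c r ^ 2 * u1 r ez ^ 2 := by
    rw [ez_t, expWeight_sq]; ring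
  obtain ⟨hdi, hfi, hdf⟩ := hu.integral_divergence hH hR (X := fun _ => ez) (X' := 0)
    (fun r => hasFDerivAt_const _ _) continuous_const (D := 0) (by simp)
    (a := 0) (b := 5) (by norm_num) le_rfl (by norm_num) (fun x hx => by
      simp only [hflux]
      exact (((continuous_expWeight σ c).comp (Continuous.prodMk_right x)).pow 2).continuousOn.mul
        ((hu.deriv_cont x hx (0, 1)).pow 2))
  simp only [hflux] at hfi hdf
  have hE := boundedContinuous_expWeight_sq_mul (σ := σ) (c := c)
    ((hu.boundedContinuous_energy.const_mul (20 * σ)).add (hu.boundedContinuous_prin.pow 2))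
  have hnn (r : SpaceTime m) :
      0 ≤ expWeight σ c r ^ 2 * (20 * σ * energy u1 r + prin u2 r ^ 2) := by
    have := energy_nonneg u1 r
    have : 0 ≤ σ := by linarith
    positivity
  have hnn' : 0 ≤ ∫ r in cyl m (-5) 5,
      expWeight σ c r ^ 2 * (20 * σ * energy u1 r + prin u2 r ^ 2) := integral_nonneg hnn
  by_cases hI : IntegrableOn (fun x => expWeight σ c (x, 0) ^ 2 * u1 (x, 0) ez ^ 2) (unitBall m)
  swap
  · rw [integral_undef hI]
    positivity
  have hI5 : IntegrableOn (fun x => expWeight σ c (x, 5) ^ 2 * u1 (x, 5) ez ^ 2)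
      (unitBall m) := by
    refine (hfi.add hI).congr (ae_of_all _ fun x => ?_)
    simp
  rw [integral_sub hI5 hI] at hdf
  have htop : ∫ x in unitBall m, expWeight σ c (x, 5) ^ 2 * u1 (x, 5) ez ^ 2
      ≤ M ^ 2 * volume.real (unitBall m) * Real.exp (2 * σ * (2063 / 1000)) := by
    refine (Real.le_norm_self _).trans ((norm_setIntegral_le_of_norm_le_const
      volume_unitBall_lt_top fun x hx => ?_).trans (le_of_eq (mul_right_comm (M ^ 2)
        (Real.exp (2 * σ * (2063 / 1000))) _)))
    rw [Real.norm_eq_abs, abs_of_nonneg (by positivity), mul_comm]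
    refine mul_le_mul ?_ ?_ (sq_nonneg _) (sq_nonneg _)
    · rw [← sq_abs]
      exact pow_le_pow_left₀ (abs_nonneg _)
        (abs_apply_le (hM (x, 5) ⟨hx, by norm_num⟩).2 norm_ez) 2
    · rw [expWeight_sq, expWeight]
      exact Real.exp_le_exp.2 (mul_le_mul_of_nonneg_left
        (weight_upper_bound hc hx (by norm_num)) (by linarith))
  have hdiv := setIntegral_mono_on hdi.neg (hE.integrableOn (a := 0) (b := 5) (by norm_num) le_rfl)
    (isOpen_cyl (m := m) 0 5).measurableSet ?_
  · have hmono := setIntegral_mono_set (hE.integrableOn (a := -5) (b := 5) le_rfl le_rfl)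
      (ae_of_all _ hnn) (cyl_subset (m := m) (by norm_num : (-5 : ℝ) ≤ 0) le_rfl).eventuallyLE
    rw [integral_neg'] at hdiv
    linarith
  · intro r hr
    have hr' := cyl_subset (by norm_num : (-5 : ℝ) ≤ 0) le_rfl hr
    have hs := hu.symm r hr'
    refine (neg_le_abs _).trans ?_
    have hb := abs_cross_terms_le hσ hc hr'.1 (abs_le.2 ⟨hr'.2.1.1.le, hr'.2.1.2.le⟩)
      (u1 r ez) (prin u2 r) (fun i => u1 r (ey i))
    have hb := mul_le_mul_of_nonneg_left hb (sq_nonneg (expWeight σ c r))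
    rw [← abs_of_nonneg (sq_nonneg (expWeight σ c r)), ← abs_mul,
      abs_of_nonneg (sq_nonneg (expWeight σ c r))] at hb
    refine le_trans (le_of_eq (congrArg _ ?_)) hb
    rw [expWeight_sq]
    have hsum : ∑ i, u1 r (ey i) * (expWeight (2 * σ) c r • u2 r ez
          + u1 r ez • ((2 * σ * expWeight (2 * σ) c r) • weight1 c r)) (ey i)
        = expWeight (2 * σ) c r * ∑ i, u1 r (ey i) * u2 r (ey i) ez
          + 9 / 5 * σ * expWeight (2 * σ) c r * u1 r ez
            * ∑ i, (r.1.1 i - c i) * u1 r (ey i) := by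
      rw [Finset.mul_sum, Finset.mul_sum, ← Finset.sum_add_distrib]
      refine Finset.sum_congr rfl fun i _ => ?_
      simp [hs ez (ey i)]
      ring
    have hN : nullForm' u1 u2 r ez =
        2 * u1 r ez * u2 r et ez + 2 * u1 r et * u2 r ez ez
        - 2 * u1 r ez * u2 r ez ez - 2 * ∑ i, u1 r (ey i) * u2 r (ey i) ez := by
      simp [nullForm', Finset.mul_sum, mul_assoc]
    simp only [hsum]
    simp only [_root_.add_apply, _root_.smul_apply, smul_eq_mul, hN, weight1_ez, weight1_et,
      hs et ez, PlaneWave.nullForm, ← pow_two]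
    ring

end Admissible

lemma expWeight_sq_eq (σ : ℝ) (c : EuclideanSpace ℝ (Fin m)) (x : Space m) (τ : ℝ) :
    expWeight σ c (x, τ) ^ 2 = expWeight σ c (x, 0) ^ 2 * Real.exp (-(47 / 100 * σ) * τ ^ 2) := by
  rw [expWeight_sq, expWeight_sq, expWeight, expWeight, ← Real.exp_add]
  congr 1
  simp only [weight]
  ring

lemma weighted_cyl_integral_le {σ : ℝ} (hσ : 0 < σ) (c : EuclideanSpace ℝ (Fin m))
    (p : Space m → ℝ) :
    ∫ r in cyl m (-5) 5, expWeight σ c r ^ 2 * p r.1 ^ 2 ≤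
      Real.sqrt (Real.pi / (47 / 100 * σ))
        * ∫ x in unitBall m, expWeight σ c (x, 0) ^ 2 * p x ^ 2 := by
  have hfac (r : SpaceTime m) : expWeight σ c r ^ 2 * p r.1 ^ 2
      = (expWeight σ c (r.1, 0) ^ 2 * p r.1 ^ 2) * Real.exp (-(47 / 100 * σ) * r.2 ^ 2) := by
    rw [← Prod.mk.eta (p := r), expWeight_sq_eq]; ring
  rw [funext hfac, cyl, Measure.volume_eq_prod, setIntegral_prod_mul
    (fun x => expWeight σ c (x, 0) ^ 2 * p x ^ 2) (fun τ => Real.exp (-(47 / 100 * σ) * τ ^ 2)),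
    mul_comm, ← integral_gaussian]
  refine mul_le_mul_of_nonneg_right ?_ (integral_nonneg fun x => by positivity)
  exact setIntegral_le_integral (integrable_exp_neg_mul_sq (by positivity))
    (ae_of_all _ fun τ => (Real.exp_pos _).le)

lemma exists_norm_eq (hm : 1 ≤ m) : ∃ c : EuclideanSpace ℝ (Fin m), ‖c‖ = 16 / 5 :=
  ⟨EuclideanSpace.single ⟨0, hm⟩ (16 / 5), by simp⟩

/-- The combination of the Carleman estimate with the trace estimate. -/
lemma Admissible.eventually_trace_le {u : SpaceTime m → ℝ}
    {u1 : SpaceTime m → SpaceTime m →L[ℝ] ℝ}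
    {u2 : SpaceTime m → SpaceTime m → SpaceTime m →L[ℝ] ℝ} (hu : Admissible u u1 u2)
    {c : EuclideanSpace ℝ (Fin m)} (hc : ‖c‖ = 16 / 5) {M : ℝ}
    (hM : ∀ r ∈ unitBall m ×ˢ Icc (-5 : ℝ) 5, |u r| ≤ M ∧ ‖u1 r‖ ≤ M)
    {p : Space m → ℝ} (hp : Continuous p) {C : ℝ}
    (hpde : ∀ r ∈ cyl m (-5) 5, |prin u2 r| ≤ C * (|p r.1| + |u r|))
    (htr : ∀ x ∈ unitBall m, u1 (x, 0) ez = p x) :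
    ∃ A, ∀ᶠ σ in atTop, ∫ x in unitBall m, expWeight σ c (x, 0) ^ 2 * p x ^ 2
      ≤ A * (σ ^ 5 * Real.exp (2 * σ * (2063 / 1000))) := by
  obtain ⟨C1, hC1, h1⟩ := hu.weighted_energy_le hc hM
  obtain ⟨C2, hC2, h2⟩ := hu.trace_le hc hM
  refine ⟨2 * (20 * C1 + 2 * C ^ 2 * C1 + C2), ?_⟩
  have hlim : Tendsto (fun σ : ℝ => 1004 * C ^ 2 * Real.sqrt (Real.pi / (47 / 100 * σ))) atTop
      (𝓝 (1004 * C ^ 2 * Real.sqrt 0)) :=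
    (((tendsto_id.const_mul_atTop (by norm_num : (0 : ℝ) < 47 / 100)).const_div_atTop
      Real.pi).sqrt).const_mul _
  rw [Real.sqrt_zero, mul_zero] at hlim
  filter_upwards [eventually_ge_atTop 10, eventually_ge_atTop (50 * C ^ 2),
    hlim.eventually_le_const (by norm_num : (0 : ℝ) < 1 / 2)] with σ hσ hσC hσs
  have hms := (isOpen_cyl (m := m) (-5) 5).measurableSet
  have int {f : SpaceTime m → ℝ} (hf : BoundedContinuous f) :
      IntegrableOn (fun r => expWeight σ c r ^ 2 * f r) (cyl m (-5) 5) :=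
    (Admissible.boundedContinuous_expWeight_sq_mul hf).integrableOn le_rfl le_rfl
  have iE := int hu.boundedContinuous_energy
  have iU := int (hu.base.boundedContinuous.pow 2)
  have iF := int (hu.boundedContinuous_prin.pow 2)
  have iJ : IntegrableOn (fun r : SpaceTime m => expWeight σ c r ^ 2 * p r.1 ^ 2)
      (cyl m (-5) 5) := int ((BoundedContinuous.of_continuous (hp.comp continuous_fst)).pow 2)
  have h1 := h1 σ hσ
  have h2 := h2 σ hσ
  have hJ := weighted_cyl_integral_le (by linarith : 0 < σ) c p
  have eI : ∫ x in unitBall m, expWeight σ c (x, 0) ^ 2 * u1 (x, 0) ez ^ 2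
      = ∫ x in unitBall m, expWeight σ c (x, 0) ^ 2 * p x ^ 2 :=
    setIntegral_congr_fun isOpen_unitBall.measurableSet fun x hx => by simp only [htr x hx]
  have e1 : ∫ r in cyl m (-5) 5, expWeight σ c r ^ 2 * (energy u1 r + σ ^ 2 * u r ^ 2)
      = (∫ r in cyl m (-5) 5, expWeight σ c r ^ 2 * energy u1 r)
        + σ ^ 2 * ∫ r in cyl m (-5) 5, expWeight σ c r ^ 2 * u r ^ 2 := by
    rw [← integral_const_mul, ← integral_add iE (iU.const_mul _)]
    congr 1 with r
    ring
  have e2 : ∫ r in cyl m (-5) 5, expWeight σ c r ^ 2 * (20 * σ * energy u1 r + prin u2 r ^ 2)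
      = 20 * σ * (∫ r in cyl m (-5) 5, expWeight σ c r ^ 2 * energy u1 r)
        + ∫ r in cyl m (-5) 5, expWeight σ c r ^ 2 * prin u2 r ^ 2 := by
    rw [← integral_const_mul, ← integral_add (iE.const_mul _) iF]
    congr 1 with r
    ring
  have hF : ∫ r in cyl m (-5) 5, expWeight σ c r ^ 2 * prin u2 r ^ 2
      ≤ 2 * C ^ 2 * ((∫ r in cyl m (-5) 5, expWeight σ c r ^ 2 * p r.1 ^ 2)
        + ∫ r in cyl m (-5) 5, expWeight σ c r ^ 2 * u r ^ 2) := by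
    rw [← integral_add iJ iU, ← integral_const_mul]
    refine setIntegral_mono_on iF ((iJ.add iU).const_mul _) hms fun r hr => ?_
    have := pow_le_pow_left₀ (abs_nonneg _) (hpde r hr) 2
    rw [sq_abs] at this
    rw [← mul_add, mul_left_comm]
    refine mul_le_mul_of_nonneg_left (this.trans ?_) (sq_nonneg _)
    rw [mul_pow, ← sq_abs (p r.1), ← sq_abs (u r)]
    nlinarith [mul_nonneg (sq_nonneg C) (sq_nonneg (|p r.1| - |u r|))]
  rw [e1] at h1
  rw [eI, e2] at h2
  have nE : 0 ≤ ∫ r in cyl m (-5) 5, expWeight σ c r ^ 2 * energy u1 r :=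
    integral_nonneg fun r => mul_nonneg (sq_nonneg _) (energy_nonneg _ _)
  have nU : 0 ≤ ∫ r in cyl m (-5) 5, expWeight σ c r ^ 2 * u r ^ 2 :=
    integral_nonneg fun r => by positivity
  have nJ : 0 ≤ ∫ r in cyl m (-5) 5, expWeight σ c r ^ 2 * p r.1 ^ 2 :=
    integral_nonneg fun r => by positivity
  have nI : 0 ≤ ∫ x in unitBall m, expWeight σ c (x, 0) ^ 2 * p x ^ 2 :=
    integral_nonneg fun r => by positivity
  generalize ∫ r in cyl m (-5) 5, expWeight σ c r ^ 2 * energy u1 r = E at *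
  generalize ∫ r in cyl m (-5) 5, expWeight σ c r ^ 2 * u r ^ 2 = U at *
  generalize ∫ r in cyl m (-5) 5, expWeight σ c r ^ 2 * p r.1 ^ 2 = J at *
  generalize ∫ r in cyl m (-5) 5, expWeight σ c r ^ 2 * prin u2 r ^ 2 = F at *
  generalize ∫ x in unitBall m, expWeight σ c (x, 0) ^ 2 * p x ^ 2 = I at *
  have hX : 0 < Real.exp (2 * σ * (2063 / 1000)) := Real.exp_pos _
  generalize Real.exp (2 * σ * (2063 / 1000)) = X at *
  have hσ0 : 0 < σ := by linarith
  have hk : 50 * C ^ 2 / σ ≤ 1 := by rw [div_le_one hσ0]; exact hσC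
  have hk0 : 0 ≤ 50 * C ^ 2 / σ := by positivity
  have hFs : 25 / σ * F ≤ 50 * C ^ 2 / σ * (J + U) := by
    refine (mul_le_mul_of_nonneg_left hF (by positivity)).trans (le_of_eq (by ring))
  have hEU : E + σ ^ 2 * U ≤ 50 * C ^ 2 / σ * J + U + C1 * (σ ^ 4 * X) := by
    nlinarith
  have hσ2 : 2 ≤ σ ^ 2 := by nlinarith
  have hE : E ≤ 50 * C ^ 2 / σ * J + C1 * (σ ^ 4 * X) := by nlinarith
  have hU : U ≤ J + C1 * (σ ^ 4 * X) := by nlinarith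
  have hσE : 20 * σ * E ≤ 1000 * C ^ 2 * J + 20 * C1 * (σ ^ 5 * X) := by
    refine (mul_le_mul_of_nonneg_left hE (by linarith : 0 ≤ 20 * σ)).trans (le_of_eq ?_)
    field_simp
    ring
  have hF' : F ≤ 4 * C ^ 2 * J + 2 * C ^ 2 * C1 * (σ ^ 4 * X) := by
    refine hF.trans ((mul_le_mul_of_nonneg_left (add_le_add_right hU J)
      (by positivity : 0 ≤ 2 * C ^ 2)).trans (le_of_eq (by ring)))
  have hp4 : σ ^ 4 * X ≤ σ ^ 5 * X :=
    mul_le_mul_of_nonneg_right (pow_le_pow_right₀ (by linarith) (by norm_num)) hX.le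
  have hp0 : X ≤ σ ^ 5 * X := le_mul_of_one_le_left hX.le (one_le_pow₀ (by linarith))
  have hF4 := mul_le_mul_of_nonneg_left hp4 (by positivity : 0 ≤ 2 * C ^ 2 * C1)
  have hC2' := mul_le_mul_of_nonneg_left hp0 hC2
  have hJI : 1004 * C ^ 2 * J ≤ 1 / 2 * I := by
    refine (mul_le_mul_of_nonneg_left hJ (by positivity)).trans ?_
    rw [← mul_assoc]
    exact mul_le_mul_of_nonneg_right hσs nI
  linarith

/-- The uniqueness theorem in the coordinates `τ = t - z`. -/
theorem Admissible.source_eq_zero (hm : 1 ≤ m) {u : SpaceTime m → ℝ}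
    {u1 : SpaceTime m → SpaceTime m →L[ℝ] ℝ}
    {u2 : SpaceTime m → SpaceTime m → SpaceTime m →L[ℝ] ℝ} (hu : Admissible u u1 u2) {M : ℝ}
    (hM : ∀ r ∈ unitBall m ×ˢ Icc (-5 : ℝ) 5, |u r| ≤ M ∧ ‖u1 r‖ ≤ M)
    {p : Space m → ℝ} (hp : Continuous p) {C : ℝ}
    (hpde : ∀ r ∈ cyl m (-5) 5, |prin u2 r| ≤ C * (|p r.1| + |u r|))
    (htr : ∀ x ∈ unitBall m, u1 (x, 0) ez = p x) :
    ∀ x ∈ unitBall m, p x = 0 := by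
  obtain ⟨c, hc⟩ := exists_norm_eq hm
  obtain ⟨A, hA⟩ := hu.eventually_trace_le hc hM hp hpde htr
  have int {f : Space m → ℝ} (hf : Continuous f) : IntegrableOn f (unitBall m) := by
    obtain ⟨N, hN⟩ := isBounded_unitBall.isCompact_closure.exists_bound_of_continuousOn
      (hf.continuousOn (s := closure (unitBall m)))
    exact integrableOn_of_continuousOn_of_bounded hf.continuousOn isOpen_unitBall.measurableSet
      volume_unitBall_lt_top fun x hx => hN x (subset_closure hx)
  have hlim : Tendsto (fun σ : ℝ => A * (23 / 100) ^ (-5 : ℤ) *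
      ((23 / 100 * σ) ^ 5 * Real.exp (-(23 / 100 * σ)))) atTop
      (𝓝 (A * (23 / 100) ^ (-5 : ℤ) * 0)) :=
    ((Real.tendsto_pow_mul_exp_neg_atTop_nhds_zero 5).comp
      (tendsto_id.const_mul_atTop (by norm_num : (0 : ℝ) < 23 / 100))).const_mul _
  rw [mul_zero] at hlim
  have hle : ∫ x in unitBall m, p x ^ 2 ≤ 0 := by
    refine ge_of_tendsto hlim ?_
    filter_upwards [hA, eventually_ge_atTop 0] with σ hσ hσ0
    have hlow : Real.exp (2 * σ * (2178 / 1000)) * ∫ x in unitBall m, p x ^ 2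
        ≤ ∫ x in unitBall m, expWeight σ c (x, 0) ^ 2 * p x ^ 2 := by
      rw [← integral_const_mul]
      have hw : Continuous fun x : Space m => expWeight σ c (x, 0) :=
        (continuous_expWeight σ c).comp (Continuous.prodMk_left 0)
      refine setIntegral_mono_on ((int (hp.pow 2)).const_mul _) (int ((hw.pow 2).mul (hp.pow 2)))
        isOpen_unitBall.measurableSet fun x hx => ?_
      refine mul_le_mul_of_nonneg_right ?_ (sq_nonneg _)
      rw [expWeight_sq, expWeight]
      exact Real.exp_le_exp.2 (mul_le_mul_of_nonneg_left (weight_lower_bound hc hx) (by linarith))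
    have h := hlow.trans hσ
    have hexp : Real.exp (2 * σ * (2063 / 1000))
        = Real.exp (2 * σ * (2178 / 1000)) * Real.exp (-(23 / 100 * σ)) := by
      rw [← Real.exp_add]; congr 1; ring
    rw [hexp] at h
    refine le_of_mul_le_mul_left (h.trans (le_of_eq ?_)) (Real.exp_pos (2 * σ * (2178 / 1000)))
    rw [zpow_neg]
    norm_num
    ring
  have hae : (fun x => p x ^ 2) =ᵐ[volume.restrict (unitBall m)] 0 :=
    (integral_eq_zero_iff_of_nonneg (fun x => sq_nonneg (p x)) (int (hp.pow 2))).1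
      (le_antisymm hle (integral_nonneg fun x => sq_nonneg (p x)))
  have : (volume : Measure (Space m)).IsOpenPosMeasure :=
    inferInstanceAs (Measure.prod volume volume).IsOpenPosMeasure
  have h0 := Measure.eqOn_open_of_ae_eq hae isOpen_unitBall (hp.pow 2).continuousOn
    continuousOn_const
  exact fun x hx => pow_eq_zero_iff (two_ne_zero) |>.1 (h0 hx)

/-- The closed Euclidean unit ball of `ℝ^m × ℝ`. -/
def closedUnitBall (m : ℕ) : Set (Space m) := {x | ‖x.1‖ ^ 2 + x.2 ^ 2 ≤ 1}

/-- The closed cylinder over the unit ball. -/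
def slab (m : ℕ) (a b : ℝ) : Set (SpaceTime m) := closedUnitBall m ×ˢ Icc a b

lemma unitBall_subset : unitBall m ⊆ closedUnitBall m :=
  fun x (hx : ‖x.1‖ ^ 2 + x.2 ^ 2 < 1) => hx.le

lemma isClosed_closedUnitBall : IsClosed (closedUnitBall m) :=
  isClosed_le (by fun_prop) continuous_const

lemma isCompact_closedUnitBall : IsCompact (closedUnitBall m) := by
  refine Metric.isCompact_of_isClosed_isBounded isClosed_closedUnitBall
    ((Metric.isBounded_closedBall (x := (0 : Space m)) (r := 1)).subset fun x hx => ?_)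
  have hx : ‖x.1‖ ^ 2 + x.2 ^ 2 ≤ 1 := hx
  rw [mem_closedBall_zero_iff, Prod.norm_def, max_le_iff, Real.norm_eq_abs, abs_le]
  exact ⟨by nlinarith [sq_nonneg x.2, norm_nonneg x.1],
    by nlinarith [sq_nonneg ‖x.1‖], by nlinarith [sq_nonneg ‖x.1‖]⟩

lemma convex_closedUnitBall : Convex ℝ (closedUnitBall m) := by
  have h1 : ConvexOn ℝ univ fun x : Space m => ‖x.1‖ ^ 2 :=
    ((convexOn_univ_norm (E := EuclideanSpace ℝ (Fin m))).comp_linearMap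
      (LinearMap.fst ℝ _ ℝ)).pow (fun _ _ => norm_nonneg _) 2
  have h2 : ConvexOn ℝ univ fun x : Space m => x.2 ^ 2 :=
    (even_two.convexOn_pow (𝕜 := ℝ)).comp_linearMap (LinearMap.snd ℝ (EuclideanSpace ℝ (Fin m)) ℝ)
  simpa [closedUnitBall] using (h1.add h2).convex_le 1

lemma isCompact_slab (a b : ℝ) : IsCompact (slab m a b) :=
  isCompact_closedUnitBall.prod isCompact_Icc

lemma convex_slab (a b : ℝ) : Convex ℝ (slab m a b) := convex_closedUnitBall.prod (convex_Icc a b)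

lemma prod_Ioo_subset_interior_slab (a b : ℝ) : unitBall m ×ˢ Ioo a b ⊆ interior (slab m a b) :=
  interior_maximal (prod_mono unitBall_subset Ioo_subset_Icc_self) (isOpen_unitBall.prod isOpen_Ioo)

lemma slab_mem_nhds {a b : ℝ} {r : SpaceTime m} (hr : r ∈ unitBall m ×ˢ Ioo a b) :
    slab m a b ∈ 𝓝 r :=
  mem_interior_iff_mem_nhds.1 (prod_Ioo_subset_interior_slab a b hr)

lemma uniqueDiffOn_slab {a b : ℝ} (hab : a < b) : UniqueDiffOn ℝ (slab m a b) :=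
  uniqueDiffOn_convex (convex_slab a b) ⟨(0, (a + b) / 2), prod_Ioo_subset_interior_slab a b
    ⟨by simp [unitBall], by constructor <;> simp only <;> linarith⟩⟩

lemma exists_bound_of_contDiffOn_slab {a b : ℝ} (hab : a < b) {g : SpaceTime m → ℝ}
    (hg : ContDiffOn ℝ 1 g (slab m a b)) :
    ∃ M, ∀ r ∈ slab m a b, |g r| ≤ M ∧ ‖fderivWithin ℝ g (slab m a b) r‖ ≤ M := by
  obtain ⟨M, hM⟩ := (isCompact_slab a b).exists_bound_of_continuousOn hg.continuousOn
  obtain ⟨N, hN⟩ := (isCompact_slab a b).exists_bound_of_continuousOn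
    (hg.continuousOn_fderivWithin (uniqueDiffOn_slab hab) le_rfl)
  exact ⟨max M N, fun r hr => ⟨(hM r hr).trans (le_max_left _ _),
    (hN r hr).trans (le_max_right _ _)⟩⟩

/-- A function that is continuously differentiable on the closed slab and vanishes at a boundary
point grows at most linearly away from it. -/
lemma exists_abs_le_of_contDiffOn_slab {a b : ℝ} (hab : a < b) {g : SpaceTime m → ℝ}
    (hg : ContDiffOn ℝ 1 g (slab m a b)) {x : Space m} (hx : x ∈ closedUnitBall m) {τ : ℝ}
    (hτ : τ ∈ Icc a b) (h0 : g (x, τ) = 0) :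
    ∃ M, ∀ x' ∈ closedUnitBall m, |g (x', τ)| ≤ M * ‖x' - x‖ := by
  obtain ⟨M, hM⟩ := exists_bound_of_contDiffOn_slab hab hg
  refine ⟨M, fun x' hx' => ?_⟩
  have := (convex_slab a b).norm_image_sub_le_of_norm_fderivWithin_le
    (hg.differentiableOn one_ne_zero) (fun r hr => (hM r hr).2)
    (x := (x, τ)) (y := (x', τ)) ⟨hx, hτ⟩ ⟨hx', hτ⟩
  rw [h0, sub_zero] at this
  simpa [Prod.norm_def] using this

open Classical in
/-- The function equal to `gp` for `τ ≥ 0` and to `gm` for `τ < 0` over the unit ball, and to zero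
elsewhere. -/
noncomputable def glue {G : Type*} [Zero G] (gp gm : SpaceTime m → G) (r : SpaceTime m) : G :=
  if r.1 ∈ unitBall m then if 0 ≤ r.2 then gp r else gm r else 0

section Glue

variable {G : Type*} [Zero G] {gp gm : SpaceTime m → G} {r : SpaceTime m}

lemma glue_of_nonneg (hr : r.1 ∈ unitBall m) (h : 0 ≤ r.2) : glue gp gm r = gp r := by
  simp [glue, hr, h]

lemma glue_of_neg (hr : r.1 ∈ unitBall m) (h : r.2 < 0) : glue gp gm r = gm r := by
  simp [glue, hr, h.not_ge]

lemma glue_of_notMem (hr : r.1 ∉ unitBall m) : glue gp gm r = 0 := by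
  simp [glue, hr]

lemma cyl_cases (hr : r ∈ cyl m (-5) 5) :
    r ∈ unitBall m ×ˢ Ioo (0 : ℝ) 5 ∨ r ∈ unitBall m ×ˢ Ioo (-5 : ℝ) 0 := by
  obtain ⟨h1, ⟨h2, h3⟩, h4⟩ := hr
  rcases lt_or_gt_of_ne h4 with h | h
  · exact Or.inr ⟨h1, h2, h⟩
  · exact Or.inl ⟨h1, h, h3⟩

lemma glue_eventuallyEq_of_pos (hr : r ∈ unitBall m ×ˢ Ioo (0 : ℝ) 5) : glue gp gm =ᶠ[𝓝 r] gp := by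
  filter_upwards [(isOpen_unitBall.prod isOpen_Ioo).mem_nhds hr] with r' hr'
  exact glue_of_nonneg hr'.1 hr'.2.1.le

lemma glue_eventuallyEq_of_neg (hr : r ∈ unitBall m ×ˢ Ioo (-5 : ℝ) 0) :
    glue gp gm =ᶠ[𝓝 r] gm := by
  filter_upwards [(isOpen_unitBall.prod isOpen_Ioo).mem_nhds hr] with r' hr'
  exact glue_of_neg hr'.1 hr'.2.2

end Glue

lemma glue_apply (gp gm : SpaceTime m → SpaceTime m →L[ℝ] ℝ) (r e : SpaceTime m) :
    glue gp gm r e = glue (fun r => gp r e) (fun r => gm r e) r := by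
  unfold glue; split_ifs <;> rfl

lemma exists_bound_glue {gp gm : SpaceTime m → ℝ} (hp : ContDiffOn ℝ 1 gp (slab m 0 5))
    (hn : ContDiffOn ℝ 1 gm (slab m (-5) 0)) :
    ∃ M, ∀ r ∈ unitBall m ×ˢ Icc (-5 : ℝ) 5, |glue gp gm r| ≤ M ∧
      ‖glue (fderivWithin ℝ gp (slab m 0 5)) (fderivWithin ℝ gm (slab m (-5) 0)) r‖ ≤ M := by
  obtain ⟨M, hM⟩ := exists_bound_of_contDiffOn_slab (by norm_num) hp
  obtain ⟨N, hN⟩ := exists_bound_of_contDiffOn_slab (by norm_num) hn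
  refine ⟨max M N, fun r hr => ?_⟩
  rcases le_or_gt 0 r.2 with h | h
  · obtain ⟨h1, h2⟩ := hM r ⟨unitBall_subset hr.1, h, hr.2.2⟩
    rw [glue_of_nonneg hr.1 h, glue_of_nonneg hr.1 h]
    exact ⟨h1.trans (le_max_left _ _), h2.trans (le_max_left _ _)⟩
  · obtain ⟨h1, h2⟩ := hN r ⟨unitBall_subset hr.1, hr.2.1, h.le⟩
    rw [glue_of_neg hr.1 h, glue_of_neg hr.1 h]
    exact ⟨h1.trans (le_max_right _ _), h2.trans (le_max_right _ _)⟩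

lemma vanishesToOrder_glue {gp gm : SpaceTime m → ℝ} (hp : ContDiffOn ℝ 1 gp (slab m 0 5))
    (hn : ContDiffOn ℝ 1 gm (slab m (-5) 0))
    (hp0 : ∀ x ∈ closedUnitBall m \ unitBall m, ∀ τ ∈ Ioo (0 : ℝ) 5, gp (x, τ) = 0)
    (hn0 : ∀ x ∈ closedUnitBall m \ unitBall m, ∀ τ ∈ Ioo (-5 : ℝ) 0, gm (x, τ) = 0) :
    VanishesToOrder 1 (glue gp gm)
      (glue (fderivWithin ℝ gp (slab m 0 5)) (fderivWithin ℝ gm (slab m (-5) 0))) where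
  hasFDerivAt r hr := by
    rcases cyl_cases hr with h | h
    · rw [(glue_eventuallyEq_of_pos h).eq_of_nhds]
      exact ((hp.differentiableOn one_ne_zero r (interior_subset
        (prod_Ioo_subset_interior_slab 0 5 h))).hasFDerivWithinAt.hasFDerivAt
        (slab_mem_nhds h)).congr_of_eventuallyEq (glue_eventuallyEq_of_pos h)
    · rw [(glue_eventuallyEq_of_neg h).eq_of_nhds]
      exact ((hn.differentiableOn one_ne_zero r (interior_subset
        (prod_Ioo_subset_interior_slab _ _ h))).hasFDerivWithinAt.hasFDerivAt
        (slab_mem_nhds h)).congr_of_eventuallyEq (glue_eventuallyEq_of_neg h)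
  cont r hr := by
    rcases cyl_cases hr with h | h
    · exact (((hp.continuousOn_fderivWithin (uniqueDiffOn_slab (by norm_num)) le_rfl).continuousAt
        (slab_mem_nhds h)).congr (glue_eventuallyEq_of_pos h).symm).continuousWithinAt
    · exact (((hn.continuousOn_fderivWithin (uniqueDiffOn_slab (by norm_num)) le_rfl).continuousAt
        (slab_mem_nhds h)).congr (glue_eventuallyEq_of_neg h).symm).continuousWithinAt
  bdd := by
    obtain ⟨M, hM⟩ := exists_bound_glue hp hn
    exact ⟨M, fun r hr => hM r (cyl_subset_closed hr)⟩
  bdry x hx τ hτ := by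
    by_cases hxc : x ∈ closedUnitBall m
    · have key : ∃ M, ∀ x' ∈ unitBall m, |glue gp gm (x', τ)| ≤ M * ‖x' - x‖ := by
        rcases lt_or_gt_of_ne hτ.2 with h | h
        · obtain ⟨M, hM⟩ := exists_abs_le_of_contDiffOn_slab (by norm_num) hn hxc
            ⟨hτ.1.1.le, le_of_lt h⟩ (hn0 x ⟨hxc, hx⟩ τ ⟨hτ.1.1, h⟩)
          exact ⟨M, fun x' hx' => by
            rw [glue_of_neg (r := (x', τ)) hx' h]; exact hM x' (unitBall_subset hx')⟩
        · obtain ⟨M, hM⟩ := exists_abs_le_of_contDiffOn_slab (by norm_num) hp hxc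
            ⟨le_of_lt h, hτ.1.2.le⟩ (hp0 x ⟨hxc, hx⟩ τ ⟨h, hτ.1.2⟩)
          exact ⟨M, fun x' hx' => by
            rw [glue_of_nonneg (r := (x', τ)) hx' (le_of_lt h)]; exact hM x' (unitBall_subset hx')⟩
      obtain ⟨M, hM⟩ := key
      refine IsBigO.of_bound |M| (Eventually.of_forall fun x' => ?_)
      rw [pow_one, norm_norm]
      by_cases hx' : x' ∈ unitBall m
      · exact (hM x' hx').trans (mul_le_mul_of_nonneg_right (le_abs_self M) (norm_nonneg _))
      · rw [glue_of_notMem (r := (x', τ)) hx', norm_zero]; positivity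
    · refine (isBigO_zero _ _).congr' ?_ EventuallyEq.rfl
      filter_upwards [isClosed_closedUnitBall.isOpen_compl.mem_nhds hxc] with x' hx'
      exact (glue_of_notMem (r := (x', τ)) fun h => hx' (unitBall_subset h)).symm

section SecondDerivative

variable {E : Type*} [NormedAddCommGroup E] [NormedSpace ℝ E] {g : E → ℝ} {r : E}

lemma fderivWithin_fderivWithin_apply {s : Set E} (hs : s ∈ 𝓝 r) (e : E) :
    fderivWithin ℝ (fun r' => fderivWithin ℝ g s r' e) s r
      = fderiv ℝ (fun r' => fderiv ℝ g r' e) r := by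
  rw [fderivWithin_of_mem_nhds hs]
  refine Filter.EventuallyEq.fderiv_eq ?_
  filter_upwards [eventually_mem_nhds_iff.2 hs] with r' hr'
  rw [fderivWithin_of_mem_nhds hr']

lemma fderiv_fderiv_apply (hg : ContDiffAt ℝ 2 g r) (e ξ : E) :
    fderiv ℝ (fun r' => fderiv ℝ g r' e) r ξ = fderiv ℝ (fderiv ℝ g) r ξ e := by
  have h := (hg.fderiv_right (m := 1) (by norm_num)).differentiableAt one_ne_zero
  rw [fderiv_clm_apply h (differentiableAt_const e)]
  simp

lemma fderiv_fderiv_symm (hg : ContDiffAt ℝ 2 g r) (e ξ : E) :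
    fderiv ℝ (fderiv ℝ g) r ξ e = fderiv ℝ (fderiv ℝ g) r e ξ :=
  hg.isSymmSndFDerivAt (by simp) ξ e

end SecondDerivative

lemma glue_fderivWithin_fderivWithin_eq {g : SpaceTime m → ℝ} {r : SpaceTime m}
    (hr : r ∈ cyl m (-5) 5) (e : SpaceTime m) :
    glue (fderivWithin ℝ (fun r' => fderivWithin ℝ g (slab m 0 5) r' e) (slab m 0 5))
      (fderivWithin ℝ (fun r' => fderivWithin ℝ g (slab m (-5) 0) r' e) (slab m (-5) 0)) r
      = fderiv ℝ (fun r' => fderiv ℝ g r' e) r := by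
  rcases cyl_cases hr with h | h
  · rw [glue_of_nonneg h.1 h.2.1.le, fderivWithin_fderivWithin_apply (slab_mem_nhds h)]
  · rw [glue_of_neg h.1 h.2.2, fderivWithin_fderivWithin_apply (slab_mem_nhds h)]

lemma contDiffAt_of_contDiffOn_slab {g : SpaceTime m → ℝ} {n : WithTop ℕ∞}
    (hp : ContDiffOn ℝ n g (slab m 0 5))
    (hn : ContDiffOn ℝ n g (slab m (-5) 0)) {r : SpaceTime m} (hr : r ∈ cyl m (-5) 5) :
    ContDiffAt ℝ n g r := by
  rcases cyl_cases hr with h | h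
  · exact hp.contDiffAt (slab_mem_nhds h)
  · exact hn.contDiffAt (slab_mem_nhds h)

lemma hasDerivAt_space_of_slab {a b : ℝ} {g : SpaceTime m → ℝ} (hg : ContDiffOn ℝ 1 g (slab m a b))
    {x : Space m} (hx : x ∈ unitBall m) {τ : ℝ} (hτ : τ ∈ Icc a b) (e : Space m) :
    HasDerivAt (fun s : ℝ => g (x + s • e, τ)) (fderivWithin ℝ g (slab m a b) (x, τ) (e, 0)) 0 := by
  have hγ : HasDerivAt (fun s : ℝ => ((x + s • e, τ) : SpaceTime m)) (e, 0) 0 := by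
    simpa using (((hasDerivAt_id (0 : ℝ)).smul_const e).const_add x).prodMk
      (hasDerivAt_const (0 : ℝ) τ)
  have h0 : ((x, τ) : SpaceTime m) = (x + (0 : ℝ) • e, τ) := by simp
  refine HasFDerivWithinAt.comp_hasDerivAt_of_eq (t := slab m a b) (0 : ℝ)
    ((hg.differentiableOn one_ne_zero (x, τ) ⟨unitBall_subset hx, hτ⟩).hasFDerivWithinAt) hγ ?_ h0
  have hc : ContinuousAt (fun s : ℝ => x + s • e) 0 := by fun_prop
  have := hc.preimage_mem_nhds (t := unitBall m) (isOpen_unitBall.mem_nhds (by simpa using hx))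
  filter_upwards [this] with s hs
  exact ⟨unitBall_subset hs, hτ⟩

/-- A function that is smooth on both sides of `τ = 0` and has vanishing Cauchy data on the lateral
boundary is admissible. -/
theorem admissible_glue {g : SpaceTime m → ℝ} (hp : ContDiffOn ℝ 2 g (slab m 0 5))
    (hn : ContDiffOn ℝ 2 g (slab m (-5) 0))
    (hp0 : ∀ x ∈ closedUnitBall m \ unitBall m, ∀ τ ∈ Ioo (0 : ℝ) 5,
      g (x, τ) = 0 ∧ fderivWithin ℝ g (slab m 0 5) (x, τ) = 0)
    (hn0 : ∀ x ∈ closedUnitBall m \ unitBall m, ∀ τ ∈ Ioo (-5 : ℝ) 0,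
      g (x, τ) = 0 ∧ fderivWithin ℝ g (slab m (-5) 0) (x, τ) = 0) :
    Admissible (glue g g)
      (glue (fderivWithin ℝ g (slab m 0 5)) (fderivWithin ℝ g (slab m (-5) 0)))
      (fun r e => glue (fderivWithin ℝ (fun r' => fderivWithin ℝ g (slab m 0 5) r' e) (slab m 0 5))
        (fderivWithin ℝ (fun r' => fderivWithin ℝ g (slab m (-5) 0) r' e) (slab m (-5) 0)) r) where
  base := vanishesToOrder_glue (hp.of_le one_le_two) (hn.of_le one_le_two)
    (fun x hx τ hτ => (hp0 x hx τ hτ).1) (fun x hx τ hτ => (hn0 x hx τ hτ).1)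
  deriv e := by
    simp only [glue_apply _ _ _ e]
    exact vanishesToOrder_glue
      ((hp.fderivWithin (uniqueDiffOn_slab (by norm_num)) (by norm_num)).clm_apply contDiffOn_const)
      ((hn.fderivWithin (uniqueDiffOn_slab (by norm_num)) (by norm_num)).clm_apply contDiffOn_const)
      (fun x hx τ hτ => by rw [(hp0 x hx τ hτ).2]; rfl)
      (fun x hx τ hτ => by rw [(hn0 x hx τ hτ).2]; rfl)
  symm r hr e ξ := by
    have h := contDiffAt_of_contDiffOn_slab hp hn hr
    rw [glue_fderivWithin_fderivWithin_eq hr, glue_fderivWithin_fderivWithin_eq hr,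
      fderiv_fderiv_apply h, fderiv_fderiv_apply h, fderiv_fderiv_symm h]
  base_cont x hx := by
    have e : (fun τ => glue g g (x, τ)) = fun τ => g (x, τ) := by
      funext τ
      simp [glue, hx]
    rw [e, ← Icc_union_Icc_eq_Icc (by norm_num : (-5 : ℝ) ≤ 0) (by norm_num)]
    exact ContinuousOn.union_of_isClosed
      (hn.continuousOn.comp (by fun_prop) fun τ hτ => ⟨unitBall_subset hx, hτ⟩)
      (hp.continuousOn.comp (by fun_prop) fun τ hτ => ⟨unitBall_subset hx, hτ⟩)
      isClosed_Icc isClosed_Icc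
  deriv_cont x hx e := by
    have hcp := hp.continuousOn_fderivWithin (uniqueDiffOn_slab (m := m) (by norm_num))
      one_le_two
    have hcn := hn.continuousOn_fderivWithin (uniqueDiffOn_slab (m := m) (by norm_num))
      one_le_two
    have hp1 : ContinuousOn (fun τ => fderivWithin ℝ g (slab m 0 5) (x, τ) (e, 0)) (Icc 0 5) :=
      (hcp.comp (f := fun τ : ℝ => (x, τ)) (by fun_prop)
        fun τ hτ => ⟨unitBall_subset hx, hτ⟩).clm_apply continuousOn_const
    have hn1 : ContinuousOn (fun τ => fderivWithin ℝ g (slab m (-5) 0) (x, τ) (e, 0))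
        (Icc (-5) 0) :=
      (hcn.comp (f := fun τ : ℝ => (x, τ)) (by fun_prop)
        fun τ hτ => ⟨unitBall_subset hx, hτ⟩).clm_apply continuousOn_const
    have h0 := (hasDerivAt_space_of_slab (hp.of_le one_le_two) hx (τ := 0) (by simp) e).unique
      (hasDerivAt_space_of_slab (hn.of_le one_le_two) hx (τ := 0) (by simp) e)
    rw [← Icc_union_Icc_eq_Icc (by norm_num : (-5 : ℝ) ≤ 0) (by norm_num)]
    refine ContinuousOn.union_of_isClosed (hn1.congr fun τ hτ => ?_) (hp1.congr fun τ hτ => ?_)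
      isClosed_Icc isClosed_Icc
    · rcases hτ.2.lt_or_eq with h | rfl
      · simp only [glue_of_neg (r := (x, τ)) hx h]
      · simp only [glue_of_nonneg (r := (x, (0 : ℝ))) hx le_rfl, h0]
    · simp only [glue_of_nonneg (r := (x, τ)) hx hτ.1]

lemma mem_sphere_iff {x : Space m} :
    x ∈ closedUnitBall m \ unitBall m ↔ ‖x.1‖ ^ 2 + x.2 ^ 2 = 1 := by
  constructor
  · rintro ⟨h1, h2⟩
    exact le_antisymm h1 (not_lt.1 h2)
  · exact fun h => ⟨h.le, h.not_lt⟩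

/-- The curve on the unit sphere obtained by normalizing a line through `x`. -/
lemma exists_curve_on_sphere {x : Space m} (hx : x ∈ closedUnitBall m \ unitBall m)
    (ξ : Space m) : ∃ b : ℝ, ∃ γ : ℝ → Space m, HasDerivAt γ (ξ - b • x) 0 ∧ γ 0 = x ∧
      ∀ᶠ s in 𝓝 0, γ s ∈ closedUnitBall m \ unitBall m := by
  rw [mem_sphere_iff] at hx
  set b := inner ℝ x.1 ξ.1 + x.2 * ξ.2 with hb
  set c := ‖ξ.1‖ ^ 2 + ξ.2 ^ 2 with hc
  set k : ℝ → ℝ := fun s => 1 + 2 * b * s + c * s ^ 2 with hk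
  have hk0 : k 0 = 1 := by simp [hk]
  have hkd : HasDerivAt k (2 * b) 0 := by
    exact ((((hasDerivAt_id (0 : ℝ)).const_mul (2 * b)).const_add 1).add
      ((hasDerivAt_pow 2 (0 : ℝ)).const_mul c)).congr_deriv (by simp)
  have hkN (s : ℝ) : ‖(x + s • ξ).1‖ ^ 2 + (x + s • ξ).2 ^ 2 = k s := by
    simp only [Prod.fst_add, Prod.smul_fst, Prod.snd_add, Prod.smul_snd, smul_eq_mul, hk, hb, hc,
      norm_add_sq_real, inner_smul_right, norm_smul, mul_pow, Real.norm_eq_abs, sq_abs]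
    linear_combination hx
  have hinv : HasDerivAt (fun s => (√(k s))⁻¹) (-b) 0 := by
    exact ((hkd.sqrt (by rw [hk0]; norm_num)).inv (by rw [hk0]; norm_num)).congr_deriv
      (by rw [hk0]; norm_num)
  refine ⟨b, fun s => (√(k s))⁻¹ • (x + s • ξ), ?_, by simp [hk0], ?_⟩
  · have h := hinv.smul (((hasDerivAt_id (0 : ℝ)).smul_const ξ).const_add x)
    simp only [id, hk0, Real.sqrt_one, inv_one, one_smul, zero_smul, add_zero, neg_smul] at h
    rwa [← sub_eq_add_neg] at h
  · have hpos : ∀ᶠ s in 𝓝 (0 : ℝ), 0 < k s :=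
      hkd.continuousAt.eventually_const_lt (by rw [hk0]; norm_num)
    filter_upwards [hpos] with s hs
    rw [mem_sphere_iff, Prod.smul_fst, Prod.smul_snd, norm_smul, smul_eq_mul, mul_pow, mul_pow,
      Real.norm_eq_abs, sq_abs, ← mul_add, hkN, inv_pow, Real.sq_sqrt hs.le, inv_mul_cancel₀ hs.ne']

/-- Vanishing Dirichlet and normal data on the lateral boundary force the full gradient to vanish
there. -/
lemma fderivWithin_slab_eq_zero {a b : ℝ} {g : SpaceTime m → ℝ} {x : Space m}
    (hx : x ∈ closedUnitBall m \ unitBall m) {τ : ℝ} (hτ : τ ∈ Ioo a b)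
    (hg : DifferentiableWithinAt ℝ g (slab m a b) (x, τ))
    (h0 : ∀ x' ∈ closedUnitBall m \ unitBall m, ∀ τ' ∈ Ioo a b, g (x', τ') = 0)
    (hrad : derivWithin (fun s : ℝ => g (s • x, τ + x.2 - s * x.2)) (Iic 1) 1 = 0) :
    fderivWithin ℝ g (slab m a b) (x, τ) = 0 := by
  set L := fderivWithin ℝ g (slab m a b) (x, τ) with hL
  have htan (ξ : Space m) : ∃ β : ℝ, ∀ t : ℝ, L (ξ - β • x, t) = 0 := by
    obtain ⟨β, γ, hγ, hγ0, hγs⟩ := exists_curve_on_sphere hx ξ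
    refine ⟨β, fun t => ?_⟩
    have hline : HasDerivAt (fun s : ℝ => τ + s * t) t 0 := by
      simpa using ((hasDerivAt_id (0 : ℝ)).mul_const t).const_add τ
    have hτs : ∀ᶠ s in 𝓝 (0 : ℝ), τ + s * t ∈ Ioo a b :=
      hline.continuousAt.preimage_mem_nhds
        (Ioo_mem_nhds (by simpa using hτ.1) (by simpa using hτ.2))
    have hd := hg.hasFDerivWithinAt.comp_hasDerivAt_of_eq (0 : ℝ) (hγ.prodMk hline)
      (by
        filter_upwards [hγs, hτs] with s h1 h2
        exact ⟨h1.1, Ioo_subset_Icc_self h2⟩) (by simp [hγ0])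
    refine hd.unique ((hasDerivAt_const (0 : ℝ) (0 : ℝ)).congr_of_eventuallyEq ?_)
    filter_upwards [hγs, hτs] with s h1 h2
    exact h0 _ h1 _ h2
  have hradL : L (x, -x.2) = 0 := by
    set ρ : ℝ → SpaceTime m := fun s => (s • x, τ + x.2 - s * x.2) with hρ
    have hρd : HasDerivAt ρ (x, -x.2) 1 := by
      simpa using ((hasDerivAt_id (1 : ℝ)).smul_const x).prodMk
        (((hasDerivAt_id (1 : ℝ)).mul_const x.2).const_sub (τ + x.2))
    have hρ1 : ((x, τ) : SpaceTime m) = ρ 1 := by simp [hρ]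
    have hev : Iic (1 : ℝ) ∩ ρ ⁻¹' slab m a b ∈ 𝓝[Iic 1] 1 := by
      have hτs : ∀ᶠ s in 𝓝 (1 : ℝ), (ρ s).2 ∈ Ioo a b :=
        (continuous_snd.continuousAt.comp hρd.continuousAt).preimage_mem_nhds
          (Ioo_mem_nhds (by simpa [hρ] using hτ.1) (by simpa [hρ] using hτ.2))
      filter_upwards [self_mem_nhdsWithin, mem_nhdsWithin_of_mem_nhds hτs,
        mem_nhdsWithin_of_mem_nhds (Ioi_mem_nhds zero_lt_one)] with s h1 h2 h3
      refine ⟨h1, ?_, Ioo_subset_Icc_self h2⟩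
      have h1 : s ≤ 1 := h1
      have h3 : 0 < s := h3
      have hx1 := mem_sphere_iff.1 hx
      change ‖(s • x).1‖ ^ 2 + (s • x).2 ^ 2 ≤ 1
      rw [Prod.smul_fst, Prod.smul_snd, norm_smul, smul_eq_mul, mul_pow, mul_pow, Real.norm_eq_abs,
        sq_abs, ← mul_add, hx1]
      nlinarith
    have hd := hg.hasFDerivWithinAt.comp_hasDerivWithinAt_of_eq (1 : ℝ) hρd.hasDerivWithinAt
      (inter_subset_right : Iic (1 : ℝ) ∩ ρ ⁻¹' slab m a b ⊆ _) hρ1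
    have := (hd.mono_of_mem_nhdsWithin hev).derivWithin (uniqueDiffWithinAt_Iic 1)
    rw [← this, ← hrad]
    rfl
  refine ContinuousLinearMap.ext fun ξ => ?_
  obtain ⟨β, hβ⟩ := htan ξ.1
  have hξ : ξ = (ξ.1 - β • x, ξ.2 + β * x.2) + β • (x, -x.2) := by
    refine Prod.ext ?_ ?_ <;> simp
  rw [hξ, map_add, map_smul, hβ, hradL]
  simp

section SecondDerivative

variable {E : Type*} [NormedAddCommGroup E] [NormedSpace ℝ E] {U : Set E}

lemma contDiffOn_fderiv_apply (hU : IsOpen U) {g : E → ℝ} (hg : ContDiffOn ℝ 2 g U) (v : E) :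
    ContDiffOn ℝ 1 (fun r => fderiv ℝ g r v) U :=
  (hg.fderiv_of_isOpen hU (by norm_num)).clm_apply contDiffOn_const

lemma continuousOn_fderiv_fderiv (hU : IsOpen U) {g : E → ℝ} (hg : ContDiffOn ℝ 2 g U) (v : E) :
    ContinuousOn (fun r => fderiv ℝ (fderiv ℝ g) r v v) U :=
  (((hg.fderiv_of_isOpen hU (m := 1) (by norm_num)).continuousOn_fderiv_of_isOpen hU
    le_rfl).clm_apply continuousOn_const).clm_apply continuousOn_const

end SecondDerivative

lemma integrable_mul_of_tsupport_subset {X : Type*} [TopologicalSpace X] [T2Space X]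
    [MeasurableSpace X] [BorelSpace X] {μ : Measure X} [IsFiniteMeasureOnCompacts μ]
    {U : Set X} (hU : IsOpen U) {g χ : X → ℝ} (hg : ContinuousOn g U)
    (hχ : Continuous χ) (hc : HasCompactSupport χ) (hs : tsupport χ ⊆ U) :
    Integrable (fun r => g r * χ r) μ := by
  refine Continuous.integrable_of_hasCompactSupport ?_ hc.mul_left
  refine continuous_iff_continuousAt.2 fun r => ?_
  by_cases hr : r ∈ tsupport χ
  · exact (hg.continuousAt (hU.mem_nhds (hs hr))).mul hχ.continuousAt
  · refine (continuousAt_const (y := (0 : ℝ))).congr ?_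
    filter_upwards [(isClosed_tsupport χ).isOpen_compl.mem_nhds hr] with r' hr'
    rw [image_eq_zero_of_notMem_tsupport hr', mul_zero]

section IntegrationByParts

variable {E : Type*} [NormedAddCommGroup E] [NormedSpace ℝ E] [FiniteDimensional ℝ E]
  [MeasurableSpace E] [BorelSpace E] {μ : Measure E} [μ.IsAddHaarMeasure] {U : Set E}

lemma integral_mul_fderiv_of_tsupport_subset (hU : IsOpen U) {g χ : E → ℝ}
    (hg : ContDiffOn ℝ 1 g U) (hχ : ContDiff ℝ 1 χ) (hc : HasCompactSupport χ)
    (hs : tsupport χ ⊆ U) (v : E) :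
    ∫ r, g r * fderiv ℝ χ r v ∂μ = -∫ r, fderiv ℝ g r v * χ r ∂μ := by
  have hg' : ContinuousOn (fun r => fderiv ℝ g r v) U :=
    (hg.continuousOn_fderiv_of_isOpen hU le_rfl).clm_apply continuousOn_const
  refine integral_bilinear_hasFDerivAt_right_eq_neg_left_of_integrable
    (B := ContinuousLinearMap.mul ℝ ℝ) (f' := fderiv ℝ g) (g' := fderiv ℝ χ)
    (integrable_mul_of_tsupport_subset hU hg' hχ.continuous hc hs)
    (integrable_mul_of_tsupport_subset hU hg.continuousOn
      ((hχ.continuous_fderiv one_ne_zero).clm_apply continuous_const) (hc.fderiv_apply ℝ v)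
      ((tsupport_fderiv_apply_subset ℝ v).trans hs))
    (integrable_mul_of_tsupport_subset hU hg.continuousOn hχ.continuous hc hs)
    (fun r hr => ?_) (fun r _ => (hχ.differentiable one_ne_zero r).hasFDerivAt)
  exact ((hg.differentiableOn one_ne_zero).differentiableAt (hU.mem_nhds (hs hr))).hasFDerivAt

lemma integral_mul_fderiv_fderiv (hU : IsOpen U) {g χ : E → ℝ}
    (hg : ContDiffOn ℝ 2 g U) (hχ : ContDiff ℝ 2 χ) (hc : HasCompactSupport χ)
    (hs : tsupport χ ⊆ U) (v : E) :
    ∫ r, g r * fderiv ℝ (fderiv ℝ χ) r v v ∂μ = ∫ r, fderiv ℝ (fderiv ℝ g) r v v * χ r ∂μ := by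
  have h1 := integral_mul_fderiv_of_tsupport_subset (μ := μ) hU (hg.of_le one_le_two)
    (contDiffOn_univ.1 (contDiffOn_fderiv_apply isOpen_univ hχ.contDiffOn v))
    (hc.fderiv_apply ℝ v) ((tsupport_fderiv_apply_subset ℝ v).trans hs) v
  have h2 := integral_mul_fderiv_of_tsupport_subset (μ := μ) hU (contDiffOn_fderiv_apply hU hg v)
    (hχ.of_le one_le_two) hc hs v
  simp only [fderiv_fderiv_apply hχ.contDiffAt] at h1
  rw [h1, h2, neg_neg]
  refine integral_congr_ae (ae_of_all _ fun r => ?_)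
  by_cases hr : r ∈ tsupport χ
  · simp only [fderiv_fderiv_apply (hg.contDiffAt (hU.mem_nhds (hs hr)))]
  · simp only [image_eq_zero_of_notMem_tsupport hr, mul_zero]

end IntegrationByParts

lemma dir2_eq {E : Type*} [NormedAddCommGroup E] [NormedSpace ℝ E] {χ : E → ℝ}
    (hχ : ContDiff ℝ 2 χ) (r v : E) : dir2 χ r v = fderiv ℝ (fderiv ℝ χ) r v v := by
  have hline (s : ℝ) : HasDerivAt (fun s : ℝ => r + s • v) v s := by
    simpa using ((hasDerivAt_id s).smul_const v).const_add r
  have h1 : deriv (fun s : ℝ => χ (r + s • v)) = fun s => fderiv ℝ χ (r + s • v) v := by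
    funext s
    exact ((hχ.differentiable two_ne_zero _).hasFDerivAt.comp_hasDerivAt s (hline s)).deriv
  have hd : Differentiable ℝ fun r' => fderiv ℝ χ r' v :=
    (contDiffOn_univ.1 (((hχ.contDiffOn (s := univ)).fderiv_of_isOpen isOpen_univ
      (m := 1) (by norm_num)).clm_apply contDiffOn_const)).differentiable one_ne_zero
  rw [dir2, iteratedDeriv_succ, iteratedDeriv_one, h1]
  have h2 := ((hd (r + (0 : ℝ) • v)).hasFDerivAt.comp_hasDerivAt (0 : ℝ) (hline 0)).deriv
  rw [zero_smul, add_zero, fderiv_fderiv_apply hχ.contDiffAt] at h2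
  exact h2

/-- The wave operator in terms of the second Fréchet derivative. -/
noncomputable def dalembertian (g : SpaceTime m → ℝ) (r : SpaceTime m) : ℝ :=
  fderiv ℝ (fderiv ℝ g) r et et
    - ((∑ i, fderiv ℝ (fderiv ℝ g) r (ey i) (ey i)) + fderiv ℝ (fderiv ℝ g) r ez ez)

lemma waveOp_eq {χ : SpaceTime m → ℝ} (hχ : ContDiff ℝ 2 χ) (r : SpaceTime m) :
    waveOp m χ r = dalembertian χ r := by
  simp only [waveOp, dir2_eq hχ]
  rfl

lemma continuousOn_dalembertian {U : Set (SpaceTime m)} (hU : IsOpen U) {g : SpaceTime m → ℝ}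
    (hg : ContDiffOn ℝ 2 g U) : ContinuousOn (dalembertian g) U :=
  (continuousOn_fderiv_fderiv hU hg et).sub
    ((continuousOn_finsetSum _ fun i _ => continuousOn_fderiv_fderiv hU hg (ey i)).add
      (continuousOn_fderiv_fderiv hU hg ez))

lemma isAddHaarMeasure_volume : (volume : Measure (SpaceTime m)).IsAddHaarMeasure := by
  have : (volume : Measure (Space m)).IsAddHaarMeasure :=
    inferInstanceAs (Measure.prod volume volume).IsAddHaarMeasure
  exact inferInstanceAs (Measure.prod volume volume).IsAddHaarMeasure

/-- The wave operator is formally self-adjoint. -/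
lemma integral_mul_dalembertian {U : Set (SpaceTime m)} (hU : IsOpen U) {g χ : SpaceTime m → ℝ}
    (hg : ContDiffOn ℝ 2 g U) (hχ : ContDiff ℝ 2 χ) (hc : HasCompactSupport χ)
    (hs : tsupport χ ⊆ U) :
    Integrable (fun r => g r * dalembertian χ r) ∧
    ∫ r, g r * dalembertian χ r = ∫ r, dalembertian g r * χ r := by
  have := isAddHaarMeasure_volume (m := m)
  have iL (v : SpaceTime m) : Integrable fun r => g r * fderiv ℝ (fderiv ℝ χ) r v v := by
    refine integrable_mul_of_tsupport_subset hU hg.continuousOn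
      (continuousOn_univ.1 (continuousOn_fderiv_fderiv isOpen_univ hχ.contDiffOn v)) ?_ ?_
    · simp only [← fderiv_fderiv_apply hχ.contDiffAt]
      exact (hc.fderiv_apply ℝ v).fderiv_apply ℝ v
    · simp only [← fderiv_fderiv_apply hχ.contDiffAt]
      exact (tsupport_fderiv_apply_subset ℝ v).trans ((tsupport_fderiv_apply_subset ℝ v).trans hs)
  have iR (v : SpaceTime m) : Integrable fun r => fderiv ℝ (fderiv ℝ g) r v v * χ r :=
    integrable_mul_of_tsupport_subset hU (continuousOn_fderiv_fderiv hU hg v) hχ.continuous hc hs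
  have eL (r : SpaceTime m) : g r * dalembertian χ r = g r * fderiv ℝ (fderiv ℝ χ) r et et
      - ((∑ i, g r * fderiv ℝ (fderiv ℝ χ) r (ey i) (ey i))
        + g r * fderiv ℝ (fderiv ℝ χ) r ez ez) := by
    simp only [dalembertian, mul_sub, mul_add, Finset.mul_sum]
  have eR (r : SpaceTime m) : dalembertian g r * χ r = fderiv ℝ (fderiv ℝ g) r et et * χ r
      - ((∑ i, fderiv ℝ (fderiv ℝ g) r (ey i) (ey i) * χ r)
        + fderiv ℝ (fderiv ℝ g) r ez ez * χ r) := by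
    simp only [dalembertian, sub_mul, add_mul, Finset.sum_mul]
  have iSL := integrable_finsetSum (Finset.univ : Finset (Fin m)) fun i _ => iL (ey i)
  have iSR := integrable_finsetSum (Finset.univ : Finset (Fin m)) fun i _ => iR (ey i)
  have iAL : Integrable fun r => (∑ i, g r * fderiv ℝ (fderiv ℝ χ) r (ey i) (ey i))
      + g r * fderiv ℝ (fderiv ℝ χ) r ez ez := iSL.add (iL ez)
  have iAR : Integrable fun r => (∑ i, fderiv ℝ (fderiv ℝ g) r (ey i) (ey i) * χ r)
      + fderiv ℝ (fderiv ℝ g) r ez ez * χ r := iSR.add (iR ez)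
  rw [funext eL, funext eR]
  refine ⟨(iL et).sub iAL, ?_⟩
  rw [integral_sub (iL et) iAL, integral_add iSL (iL ez),
    integral_finsetSum _ fun i _ => iL (ey i), integral_sub (iR et) iAR,
    integral_add iSR (iR ez), integral_finsetSum _ fun i _ => iR (ey i)]
  simp only [integral_mul_fderiv_fderiv hU hg hχ hc hs]

/-- A distributional solution that is `C²` on an open set satisfies the equation there, up to
the size of the source. -/
lemma abs_dalembertian_add_le {U : Set (SpaceTime m)} (hU : IsOpen U) {g : SpaceTime m → ℝ}
    (hg : ContDiffOn ℝ 2 g U) {p q : Space m → ℝ} (hp : Continuous p) (hq : Continuous q)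
    {f : SpaceTime m → ℝ} (hf : Measurable f) {C : ℝ} (hC : ∀ r, |f r| ≤ C)
    (hpde : ∀ χ : SpaceTime m → ℝ, ContDiff ℝ (⊤ : ℕ∞) χ → HasCompactSupport χ → tsupport χ ⊆ U →
      ∫ r, g r * (waveOp m χ r + q r.1 * χ r) = ∫ r, p r.1 * f r * χ r) :
    ∀ r ∈ U, |dalembertian g r + q r.1 * g r| ≤ C * |p r.1| := by
  have := isAddHaarMeasure_volume (m := m)
  have hp' : Continuous fun r : SpaceTime m => p r.1 := hp.comp continuous_fst
  have hq' : Continuous fun r : SpaceTime m => q r.1 := hq.comp continuous_fst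
  have hcL : ContinuousOn (fun r => dalembertian g r + q r.1 * g r) U :=
    (continuousOn_dalembertian hU hg).add (hq'.continuousOn.mul hg.continuousOn)
  have hlocR : LocallyIntegrable (fun r : SpaceTime m => p r.1 * f r) := by
    refine (hp'.mul (continuous_const (y := C))).locallyIntegrable.mono
      (hp'.measurable.mul hf).aestronglyMeasurable (ae_of_all _ fun r => ?_)
    rw [Pi.mul_apply, norm_mul, norm_mul]
    exact mul_le_mul_of_nonneg_left ((hC r).trans (le_abs_self C)) (norm_nonneg _)
  have hae := hU.ae_eq_zero_of_integral_contDiff_smul_eq_zero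
    (f := fun r => (dalembertian g r + q r.1 * g r) - p r.1 * f r) (μ := volume)
    ((hcL.locallyIntegrableOn hU.measurableSet).sub (hlocR.locallyIntegrableOn U))
    fun χ hχ hc hs => by
      have hχ2 : ContDiff ℝ 2 χ := contDiff_infty.1 hχ 2
      obtain ⟨i1, e1⟩ := integral_mul_dalembertian hU hg hχ2 hc hs
      have i2 : Integrable fun r => (q r.1 * g r) * χ r :=
        integrable_mul_of_tsupport_subset hU (hq'.continuousOn.mul hg.continuousOn) hχ.continuous
          hc hs
      have i3 : Integrable fun r => dalembertian g r * χ r :=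
        integrable_mul_of_tsupport_subset hU (continuousOn_dalembertian hU hg) hχ.continuous hc hs
      have i4 : Integrable fun r => p r.1 * f r * χ r :=
        (hlocR.integrable_smul_left_of_hasCompactSupport hχ.continuous hc).congr
          (ae_of_all _ fun r => mul_comm _ _)
      have h := hpde χ hχ hc hs
      have e2 (r : SpaceTime m) : g r * (waveOp m χ r + q r.1 * χ r)
          = g r * dalembertian χ r + (q r.1 * g r) * χ r := by
        rw [waveOp_eq hχ2]; ring
      have e3 (r : SpaceTime m) : χ r • ((dalembertian g r + q r.1 * g r) - p r.1 * f r)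
          = (dalembertian g r * χ r + (q r.1 * g r) * χ r) - p r.1 * f r * χ r := by
        rw [smul_eq_mul]; ring
      rw [funext e2, integral_add i1 i2, e1] at h
      have i5 : Integrable fun r => dalembertian g r * χ r + (q r.1 * g r) * χ r := i3.add i2
      rw [funext e3, integral_sub i5 i4, integral_add i3 i2, h, sub_self]
  by_contra! hcon
  obtain ⟨r₀, hr₀, hlt⟩ := hcon
  have hopen : IsOpen (U ∩ (fun r => |dalembertian g r + q r.1 * g r| - C * |p r.1|) ⁻¹' Ioi 0) :=
    (hcL.abs.sub (continuous_const.mul hp'.abs).continuousOn).isOpen_inter_preimage hU isOpen_Ioi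
  refine (hopen.measure_pos volume ⟨r₀, hr₀, sub_pos.2 hlt⟩).ne' ?_
  refine measure_mono_null ?_ hae
  rintro r ⟨hrU, hr⟩ h
  have hr : 0 < |dalembertian g r + q r.1 * g r| - C * |p r.1| := hr
  rw [sub_eq_zero.1 (h hrU), abs_mul, mul_comm, ← sub_mul] at hr
  exact hr.not_ge (mul_nonpos_of_nonpos_of_nonneg (sub_nonpos.2 (hC r)) (abs_nonneg _))

/-- The change of variables `(x, τ) ↦ (x, τ + z)`. -/
noncomputable def shear : SpaceTime m →L[ℝ] SpaceTime m :=
  (ContinuousLinearMap.fst ℝ _ _).prod (coordT + coordZ)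

lemma shear_apply (r : SpaceTime m) : shear r = (r.1, r.2 + r.1.2) := rfl

lemma fderiv_fderiv_comp_shear {g : SpaceTime m → ℝ} {r : SpaceTime m}
    (hg : ContDiffAt ℝ 2 g (shear r)) (e ξ : SpaceTime m) :
    fderiv ℝ (fun r' => fderiv ℝ (fun r => g (shear r)) r' e) r ξ
      = fderiv ℝ (fderiv ℝ g) (shear r) (shear ξ) (shear e) := by
  have h1 : (fun r' => fderiv ℝ (fun r => g (shear r)) r' e)
      =ᶠ[𝓝 r] fun r' => fderiv ℝ g (shear r') (shear e) := by
    filter_upwards [shear.continuous.continuousAt.eventually (hg.eventually (by simp))] with r' hr'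
    have hd := (hr'.differentiableAt two_ne_zero).hasFDerivAt.comp r' shear.hasFDerivAt
    exact congrArg (fun L : SpaceTime m →L[ℝ] ℝ => L e) hd.fderiv
  have hd : DifferentiableAt ℝ (fun r' => fderiv ℝ g r' (shear e)) (shear r) :=
    (((hg.fderiv_right (m := 1) (by norm_num)).differentiableAt one_ne_zero).clm_apply
      (differentiableAt_const _))
  have h2 := (hd.hasFDerivAt.comp r shear.hasFDerivAt).fderiv
  rw [h1.fderiv_eq, ← fderiv_fderiv_apply hg]
  exact congrArg (fun L : SpaceTime m →L[ℝ] ℝ => L ξ) h2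

lemma shear_ey (i : Fin m) : shear (ey i) = ey i := by simp [shear_apply, ey]
lemma shear_ez : shear (ez : SpaceTime m) = ez + et := by simp [shear_apply, ez, et]
lemma shear_et : shear (et : SpaceTime m) = et := by simp [shear_apply, et]

/-- The wave operator in the coordinates `τ = t - z`. -/
lemma prin_eq_dalembertian {g : SpaceTime m → ℝ}
    {u2 : SpaceTime m → SpaceTime m → SpaceTime m →L[ℝ] ℝ} {r : SpaceTime m}
    (hg : ContDiffAt ℝ 2 g (shear r))
    (hu2 : ∀ e, u2 r e = fderiv ℝ (fun r' => fderiv ℝ (fun r => g (shear r)) r' e) r) :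
    prin u2 r = dalembertian g (shear r) := by
  simp only [prin, hu2, fderiv_fderiv_comp_shear hg, shear_ey, shear_ez, shear_et, map_add,
    _root_.add_apply, dalembertian]
  rw [fderiv_fderiv_symm hg et ez]
  ring

lemma hasDerivAt_integral_Iic {h : ℝ → ℝ} (hc : Continuous h) (hi : Integrable h) (z : ℝ) :
    HasDerivAt (fun z => ∫ s in Iic z, h s) (h z) z := by
  have e : (fun w => ∫ s in Iic w, h s) = fun w => (∫ s in z..w, h s) + ∫ s in Iic z, h s := by
    funext w
    rw [← intervalIntegral.integral_Iic_sub_Iic hi.integrableOn hi.integrableOn, sub_add_cancel]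
  rw [e]
  exact (intervalIntegral.integral_hasDerivAt_right (hc.intervalIntegrable _ _)
    (hc.stronglyMeasurableAtFilter _ _) hc.continuousAt).add_const _

lemma abs_le_one_of_mem_closedUnitBall {x : Space m} (hx : x ∈ closedUnitBall m) : |x.2| ≤ 1 := by
  have hx : ‖x.1‖ ^ 2 + x.2 ^ 2 ≤ 1 := hx
  rw [abs_le]
  constructor <;> nlinarith [sq_nonneg ‖x.1‖]

lemma prod_Ioo_subset_interior_cylinderQ (T : ℝ) :
    unitBall m ×ˢ Ioo (-T) T ⊆ interior (cylinderQ m T) :=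
  interior_maximal (fun _ hr => ⟨unitBall_subset hr.1, hr.2.1.le, hr.2.2.le⟩)
    (isOpen_unitBall.prod isOpen_Ioo)

lemma isClosed_cylinderQ (T : ℝ) : IsClosed (cylinderQ m T) := by
  have h1 : IsClosed {r : SpaceTime m | ‖r.1.1‖ ^ 2 + r.1.2 ^ 2 ≤ 1} :=
    isClosed_le (by fun_prop) continuous_const
  have h2 : IsClosed {r : SpaceTime m | -T ≤ r.2} := isClosed_le continuous_const continuous_snd
  have h3 : IsClosed {r : SpaceTime m | r.2 ≤ T} := isClosed_le continuous_snd continuous_const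
  exact h1.inter (h2.inter h3)

lemma shear_mem_cylinderQ {T : ℝ} (hT : 6 < T) {r : SpaceTime m}
    (hr : r ∈ slab m (-5) 5) : shear r ∈ cylinderQ m T := by
  have h := abs_le.1 (abs_le_one_of_mem_closedUnitBall hr.1)
  have h1 := hr.2.1
  have h2 := hr.2.2
  exact ⟨hr.1, by rw [shear_apply]; simp only; linarith, by rw [shear_apply]; simp only; linarith⟩

lemma shear_mem_prod {T : ℝ} (hT : 6 < T) {r : SpaceTime m}
    (hr : r ∈ unitBall m ×ˢ Ioo (-5 : ℝ) 5) : shear r ∈ unitBall m ×ˢ Ioo (-T) T := by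
  have h := abs_le.1 (abs_le_one_of_mem_closedUnitBall (unitBall_subset hr.1))
  have h1 := hr.2.1
  have h2 := hr.2.2
  exact ⟨hr.1, by rw [shear_apply]; simp only; linarith, by rw [shear_apply]; simp only; linarith⟩

lemma mapsTo_shear_up {T : ℝ} (hT : 6 < T) :
    MapsTo shear (slab m 0 5) (cylinderQ m T ∩ {r | r.1.2 ≤ r.2}) := by
  intro r hr
  refine ⟨shear_mem_cylinderQ hT ⟨hr.1, by linarith [hr.2.1], hr.2.2⟩, ?_⟩
  have := hr.2.1
  change r.1.2 ≤ r.2 + r.1.2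
  linarith

lemma mapsTo_shear_down {T : ℝ} (hT : 6 < T) :
    MapsTo shear (slab m (-5) 0) (cylinderQ m T ∩ {r | r.2 ≤ r.1.2}) := by
  intro r hr
  refine ⟨shear_mem_cylinderQ hT ⟨hr.1, hr.2.1, by linarith [hr.2.2]⟩, ?_⟩
  have := hr.2.2
  change r.2 + r.1.2 ≤ r.1.2
  linarith

/-- On the open set where a weak solution is smooth, testing over the cylinder bounds the
wave operator by the source. -/
lemma abs_dalembertian_add_le_of_weak {T : ℝ} {p q : Space m → ℝ} (hp : Continuous p)
    (hq : Continuous q) {f : SpaceTime m → ℝ} (hf : Measurable f) {C : ℝ}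
    (hC : ∀ r ∈ cylinderQ m T, |f r| ≤ C) {g : SpaceTime m → ℝ}
    (hpde : ∀ χ : SpaceTime m → ℝ, ContDiff ℝ (⊤ : ℕ∞) χ → HasCompactSupport χ →
      tsupport χ ⊆ interior (cylinderQ m T) →
      (∫ r in cylinderQ m T, g r * (waveOp m χ r + q r.1 * χ r))
        = ∫ r in cylinderQ m T, p r.1 * f r * χ r)
    {U : Set (SpaceTime m)} (hU : IsOpen U) (hUQ : U ⊆ interior (cylinderQ m T))
    (hg : ContDiffOn ℝ 2 g U) : ∀ r ∈ U, |dalembertian g r + q r.1 * g r| ≤ |C| * |p r.1| := by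
  have hQ := (isClosed_cylinderQ (m := m) T).measurableSet
  refine abs_dalembertian_add_le hU hg hp hq (hf.indicator hQ) (fun r => ?_) fun χ hχ hc hs => ?_
  · by_cases hr : r ∈ cylinderQ m T
    · rw [indicator_of_mem hr]
      exact (hC r hr).trans (le_abs_self C)
    · rw [indicator_of_notMem hr, abs_zero]
      exact abs_nonneg C
  · have hsQ := (hs.trans hUQ).trans interior_subset
    have h := hpde χ hχ hc (hs.trans hUQ)
    rw [setIntegral_eq_integral_of_forall_compl_eq_zero, ← integral_indicator hQ] at h
    · rw [h]
      congr 1 with r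
      by_cases hr : r ∈ cylinderQ m T <;> simp [hr]
    · intro r hr
      have hr' : r ∉ tsupport χ := fun h => hr (hsQ h)
      have h2 : fderiv ℝ (fderiv ℝ χ) r = 0 := image_eq_zero_of_notMem_tsupport fun h =>
        hr' (tsupport_fderiv_subset ℝ (tsupport_fderiv_subset ℝ h))
      rw [waveOp_eq (contDiff_infty.1 hχ 2), dalembertian, h2, image_eq_zero_of_notMem_tsupport hr']
      simp

lemma hasDerivAt_of_characteristic {p : Space m → ℝ} (hp : Continuous p)
    (hpsupp : ∀ y : EuclideanSpace ℝ (Fin m), ∀ z : ℝ, 1 < ‖y‖ ^ 2 + z ^ 2 → p (y, z) = 0)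
    {α : SpaceTime m → ℝ}
    (hchar : ∀ y : EuclideanSpace ℝ (Fin m), ∀ z : ℝ, ‖y‖ ^ 2 + z ^ 2 ≤ 1 →
      α ((y, z), z) = ∫ s in Iic z, p (y, s)) {x : Space m} (hx : x ∈ unitBall m) :
    HasDerivAt (fun s : ℝ => α (shear (x + s • (0, 1), 0))) (p x) 0 := by
  obtain ⟨y, z⟩ := x
  have hc : Continuous fun s => p (y, s) := hp.comp (by fun_prop)
  have hi : Integrable fun s => p (y, s) := by
    refine hc.integrable_of_hasCompactSupport (HasCompactSupport.intro (isCompact_Icc (a := -1)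
      (b := 1)) fun s hs => hpsupp y s ?_)
    by_contra! hle
    exact hs (mem_Icc.2 (abs_le.1 (abs_le_one_of_mem_closedUnitBall (x := (y, s)) hle)))
  have hd : HasDerivAt (fun s : ℝ => ∫ w in Iic (z + s), p (y, w)) (p (y, z)) 0 := by
    have h := (hasDerivAt_integral_Iic hc hi (z + 0)).comp_const_add z 0
    rwa [add_zero] at h
  refine hd.congr_of_eventuallyEq ?_
  have hcont : Continuous fun s : ℝ => ((y, z + s) : Space m) := by fun_prop
  have hmem : (y, z + 0) ∈ unitBall m := by rwa [add_zero]
  filter_upwards [hcont.continuousAt.preimage_mem_nhds (isOpen_unitBall.mem_nhds hmem)] with s hs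
  have hs : ‖y‖ ^ 2 + (z + s) ^ 2 < 1 := hs
  have e : shear (((y, z) : Space m) + s • (0, 1), 0) = ((y, z + s), z + s) := by
    rw [shear_apply, Prod.smul_mk, smul_zero, Prod.mk_add_mk, add_zero, zero_add, smul_eq_mul,
      mul_one]
  exact (congrArg α e).trans (hchar y (z + s) hs.le)

/-- A weak solution with vanishing Cauchy data has gradient vanishing on the lateral boundary, in
the coordinates `τ = t - z`. -/
lemma boundary_data_shear {T : ℝ} (hT : 6 < T) {α : SpaceTime m → ℝ}
    (hbdry : ∀ y : EuclideanSpace ℝ (Fin m), ∀ z t : ℝ, ‖y‖ ^ 2 + z ^ 2 = 1 →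
      -T ≤ t → t ≤ T → t ≠ z → α ((y, z), t) = 0 ∧
        derivWithin (fun s : ℝ => α ((s • y, s * z), t)) (Iic 1) 1 = 0)
    {a b : ℝ} (ha : -5 ≤ a) (hb : b ≤ 5) (h0 : (0 : ℝ) ∉ Ioo a b)
    (hg : DifferentiableOn ℝ (fun r => α (shear r)) (slab m a b)) :
    ∀ x ∈ closedUnitBall m \ unitBall m, ∀ τ ∈ Ioo a b,
      α (shear (x, τ)) = 0 ∧ fderivWithin ℝ (fun r => α (shear r)) (slab m a b) (x, τ) = 0 := by
  have key : ∀ x ∈ closedUnitBall m \ unitBall m, ∀ τ ∈ Ioo a b, α (shear (x, τ)) = 0 ∧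
      derivWithin (fun s : ℝ => α ((s • x.1, s * x.2), τ + x.2)) (Iic 1) 1 = 0 := by
    intro x hx τ hτ
    have hQ := shear_mem_cylinderQ hT (r := (x, τ))
      ⟨hx.1, ha.trans hτ.1.le, hτ.2.le.trans hb⟩
    exact hbdry x.1 x.2 (τ + x.2) (mem_sphere_iff.1 hx) hQ.2.1 hQ.2.2 fun h =>
      h0 (by rwa [add_eq_right.1 h] at hτ)
  intro x hx τ hτ
  refine ⟨(key x hx τ hτ).1, fderivWithin_slab_eq_zero hx hτ
    (hg _ ⟨hx.1, Ioo_subset_Icc_self hτ⟩) (fun x' hx' τ' hτ' => (key x' hx' τ' hτ').1) ?_⟩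
  rw [← (key x hx τ hτ).2]
  congr 1
  funext s
  rw [shear_apply]
  congr 2
  simp

end PlaneWave

open PlaneWave Set Filter Topology in
/-- Proposition 2.2 (uniqueness part, main proposition for the plane wave problem):
if `(□ + q)α = p f` in the sense of distributions on the interior of `Q = B̄ × [−T,T]`
with `T > 6`, `α` restricted to the characteristic surface `t = z` is the partial
line-integral of `p`, and `α` together with its normal derivative vanish on the lateral
boundary `S × [−T,T]` (away from `t = z`), then `p = 0`. -/
theorem planewave_main_proposition (m : ℕ) (hm : 1 ≤ m) (T : ℝ) (hT : 6 < T)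
    (p q : EuclideanSpace ℝ (Fin m) × ℝ → ℝ)
    (hp : ContDiff ℝ (⊤ : ℕ∞) p) (hq : ContDiff ℝ (⊤ : ℕ∞) q)
    (hpsupp : ∀ y : EuclideanSpace ℝ (Fin m), ∀ z : ℝ, 1 < ‖y‖ ^ 2 + z ^ 2 → p (y, z) = 0)
    (hqsupp : ∀ y : EuclideanSpace ℝ (Fin m), ∀ z : ℝ, 1 < ‖y‖ ^ 2 + z ^ 2 → q (y, z) = 0)
    (f : (EuclideanSpace ℝ (Fin m) × ℝ) × ℝ → ℝ) (hf_meas : Measurable f)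
    (C : ℝ) (hf_bdd : ∀ r ∈ cylinderQ m T, |f r| ≤ C)
    (α : (EuclideanSpace ℝ (Fin m) × ℝ) × ℝ → ℝ)
    (hα_cont : ContinuousOn α (cylinderQ m T))
    -- smooth on each side of the characteristic surface t = z
    (hα_smooth_up : ContDiffOn ℝ (⊤ : ℕ∞) α (cylinderQ m T ∩ {r | r.1.2 ≤ r.2}))
    (hα_smooth_down : ContDiffOn ℝ (⊤ : ℕ∞) α (cylinderQ m T ∩ {r | r.2 ≤ r.1.2}))
    -- (i) (□ + q)α = p·f in the sense of distributions on the interior of Q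
    (hα_pde : ∀ χ : (EuclideanSpace ℝ (Fin m) × ℝ) × ℝ → ℝ, ContDiff ℝ (⊤ : ℕ∞) χ →
      HasCompactSupport χ → tsupport χ ⊆ interior (cylinderQ m T) →
      (∫ r in cylinderQ m T, α r * (waveOp m χ r + q r.1 * χ r))
        = ∫ r in cylinderQ m T, p r.1 * f r * χ r)
    -- (ii) characteristic condition on t = z
    (hα_char : ∀ y : EuclideanSpace ℝ (Fin m), ∀ z : ℝ, ‖y‖ ^ 2 + z ^ 2 ≤ 1 →
      α ((y, z), z) = ∫ s in Set.Iic z, p (y, s))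
    -- (iii) vanishing Cauchy data on the lateral boundary
    (hα_bdry : ∀ y : EuclideanSpace ℝ (Fin m), ∀ z t : ℝ, ‖y‖ ^ 2 + z ^ 2 = 1 →
      -T ≤ t → t ≤ T → t ≠ z → α ((y, z), t) = 0 ∧
        derivWithin (fun s : ℝ => α ((s • y, s * z), t)) (Set.Iic 1) 1 = 0) :
    ∀ x : EuclideanSpace ℝ (Fin m) × ℝ, p x = 0 := by
  have hup : ContDiffOn ℝ 2 α _ := contDiffOn_infty.1 hα_smooth_up 2
  have hdown : ContDiffOn ℝ 2 α _ := contDiffOn_infty.1 hα_smooth_down 2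
  have hgp : ContDiffOn ℝ 2 (fun r => α (shear r)) (slab m 0 5) :=
    hup.comp shear.contDiff.contDiffOn (mapsTo_shear_up hT)
  have hgn : ContDiffOn ℝ 2 (fun r => α (shear r)) (slab m (-5) 0) :=
    hdown.comp shear.contDiff.contDiffOn (mapsTo_shear_down hT)
  have hadm := admissible_glue hgp hgn
    (boundary_data_shear hT hα_bdry (by norm_num) (by norm_num) (by simp)
      (hgp.differentiableOn two_ne_zero))
    (boundary_data_shear hT hα_bdry (by norm_num) (by norm_num) (by simp)
      (hgn.differentiableOn two_ne_zero))
  obtain ⟨M, hM⟩ := exists_bound_glue (hgp.of_le one_le_two) (hgn.of_le one_le_two)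
  obtain ⟨N, hN⟩ := isCompact_closedUnitBall.exists_bound_of_continuousOn
    (hq.continuous.continuousOn (s := closedUnitBall m))
  have hball : ∀ x ∈ unitBall m, p x = 0 := by
    refine hadm.source_eq_zero hm hM hp.continuous (C := |C| + |N|) (fun r hr => ?_) fun x hx => ?_
    · have hSr := shear_mem_prod hT ⟨hr.1, hr.2.1⟩
      have hbox := (isOpen_unitBall (m := m)).prod (isOpen_Ioo (a := -T) (b := T))
      have hboxQ := prod_Ioo_subset_interior_cylinderQ (m := m) T
      have key : ∃ U : Set (SpaceTime m), IsOpen U ∧ U ⊆ interior (cylinderQ m T) ∧ shear r ∈ U ∧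
          ContDiffOn ℝ 2 α U := by
        rcases cyl_cases hr with h | h
        · exact ⟨_ ∩ {r | r.1.2 < r.2}, hbox.inter (isOpen_lt (by fun_prop) (by fun_prop)),
            inter_subset_left.trans hboxQ,
            ⟨hSr, by have := h.2.1; change r.1.2 < r.2 + r.1.2; linarith⟩,
            hup.mono fun r' hr' => ⟨interior_subset (hboxQ hr'.1),
              le_of_lt (show r'.1.2 < r'.2 from hr'.2)⟩⟩
        · exact ⟨_ ∩ {r | r.2 < r.1.2}, hbox.inter (isOpen_lt (by fun_prop) (by fun_prop)),
            inter_subset_left.trans hboxQ,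
            ⟨hSr, by have := h.2.2; change r.2 + r.1.2 < r.1.2; linarith⟩,
            hdown.mono fun r' hr' => ⟨interior_subset (hboxQ hr'.1),
              le_of_lt (show r'.2 < r'.1.2 from hr'.2)⟩⟩
      obtain ⟨U, hU, hUQ, hrU, hαU⟩ := key
      have hle := abs_dalembertian_add_le_of_weak hp.continuous hq.continuous hf_meas hf_bdd hα_pde
        hU hUQ hαU _ hrU
      rw [prin_eq_dalembertian (hαU.contDiffAt (hU.mem_nhds hrU))
        fun e => glue_fderivWithin_fderivWithin_eq hr e]
      have hu : glue (fun r => α (shear r)) (fun r => α (shear r)) r = α (shear r) := by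
        simp [glue, hr.1]
      have hqN : |q r.1| ≤ |N| := (hN r.1 (unitBall_subset hr.1)).trans (le_abs_self N)
      have h1 : |dalembertian α (shear r)| ≤ |C| * |p r.1| + |q r.1| * |α (shear r)| := by
        have h := abs_sub (dalembertian α (shear r) + q r.1 * α (shear r)) (q r.1 * α (shear r))
        rw [add_sub_cancel_right, abs_mul] at h
        exact h.trans (add_le_add_left hle _)
      rw [hu]
      nlinarith [mul_le_mul_of_nonneg_right hqN (abs_nonneg (α (shear r))),
        mul_nonneg (abs_nonneg N) (abs_nonneg (p r.1)),
        mul_nonneg (abs_nonneg C) (abs_nonneg (α (shear r)))]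
    · rw [glue_of_nonneg (r := (x, (0 : ℝ))) hx le_rfl]
      exact (hasDerivAt_space_of_slab (hgp.of_le one_le_two) hx (by simp) (0, 1)).unique
        (hasDerivAt_of_characteristic hp.continuous hpsupp hα_char hx)
  intro x
  rcases lt_trichotomy (‖x.1‖ ^ 2 + x.2 ^ 2) 1 with h | h | h
  · exact hball x h
  · have hc : Continuous fun s : ℝ => p (s • x) := hp.continuous.comp (by fun_prop)
    have hlim : Tendsto (fun s : ℝ => p (s • x)) (𝓝[>] 1) (𝓝 (p x)) := by
      simpa using (hc.tendsto 1).mono_left nhdsWithin_le_nhds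
    refine tendsto_nhds_unique hlim (tendsto_const_nhds.congr' ?_)
    filter_upwards [self_mem_nhdsWithin] with s hs
    have hs : 1 < s := hs
    refine (hpsupp (s • x).1 (s • x).2 ?_).symm
    rw [Prod.smul_fst, Prod.smul_snd, norm_smul, smul_eq_mul, mul_pow, mul_pow, Real.norm_eq_abs,
      sq_abs, ← mul_add, h]
    nlinarith
  · exact hpsupp x.1 x.2 h
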